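/- If κ is 2^{θ^{<κ}}-supercompact, then the local Laver diamond principle LD^{θ-sc}_κ holds: there is a partial function ℓ : κ ⇀ V_κ such that for every set A ∈ H(θ⁺) there is a θ-supercompactness embedding j : V → M with critical point κ such that j(ℓ)(κ) = A. -/

import Mathlib

open FirstOrder

universe u

namespace LaverDiamond

/-- The relation symbols of the language of set theory: a single binary relation `mem`. -/
inductive memRel : ℕ → Type
  | mem : memRel 2

/-- The first-order language of set theory. -/
def SetLang : FirstOrder.Language := ⟨fun _ => Empty, memRel⟩

/-- Any class of ZF-sets is a structure in the language of set theory, with the true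
membership relation. -/
instance classStructure (M : Set ZFSet.{u}) : SetLang.Structure M where
  funMap := fun {_} f _ => f.elim
  RelMap := fun {_} r x => match r with
    | .mem => (x 0 : ZFSet) ∈ (x 1 : ZFSet)

/-- A (fully) elementary embedding from the class `M` to the class `N`, both classes of
ZF-sets equipped with the true membership relation.  It is coded by a global function
`j : ZFSet → ZFSet` mapping `M` into `N`, elementary for all first-order formulas
with parameters from `M`. -/
structure ClassEmb (M N : Set ZFSet.{u}) where
  j : ZFSet.{u} → ZFSet.{u}
  maps : ∀ x, x ∈ M → j x ∈ N
  elem : ∀ {n : ℕ} (φ : SetLang.Formula (Fin n)) (v : Fin n → ZFSet.{u}) (hv : ∀ i, v i ∈ M),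
    φ.Realize (fun i => (⟨v i, hv i⟩ : M)) ↔ φ.Realize (fun i => (⟨j (v i), maps _ (hv i)⟩ : N))

/-- The universe of all ZF-sets, as a class. -/
def V : Set ZFSet.{u} := Set.univ

/-- A transitive class of ZF-sets. -/
def TransClass (M : Set ZFSet.{u}) : Prop := ∀ x ∈ M, ∀ y ∈ x, y ∈ M

/-- `j` has critical point `κ`: `κ` is an ordinal, fixed below `κ`, with `j(κ) > κ`. -/
def CritPt (j : ZFSet.{u} → ZFSet.{u}) (κ : ZFSet.{u}) : Prop :=
  κ.IsOrdinal ∧ κ ∈ j κ ∧ ∀ α : ZFSet, α.IsOrdinal → α ∈ κ → j α = α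

/-- `x` is a member of the rank-initial segment `V_θ`. -/
def MemV (θ x : ZFSet.{u}) : Prop := x.rank < θ.rank

/-- `κ` is a cardinal: an ordinal not equinumerous with any smaller ordinal. -/
def IsCard (κ : ZFSet.{u}) : Prop :=
  κ.IsOrdinal ∧ ∀ β ∈ κ, Cardinal.mk β.toSet < Cardinal.mk κ.toSet

/-- `x ∈ H(θ⁺)`, i.e. `x` has hereditary size at most `θ`. -/
def MemH (θ x : ZFSet.{u}) : Prop :=
  ∃ t : ZFSet, t.IsTransitive ∧ x ∈ t ∧ Cardinal.mk t.toSet ≤ Cardinal.mk θ.toSet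

/-- `f` is a set-function with domain `θ` taking values in the class `M`. -/
def IsFuncInto (θ : ZFSet.{u}) (M : Set ZFSet.{u}) (f : ZFSet.{u}) : Prop :=
  (∀ p ∈ f, ∃ a b : ZFSet, a ∈ θ ∧ b ∈ M ∧ p = ZFSet.pair a b) ∧
  ∀ a ∈ θ, ∃! b : ZFSet, ZFSet.pair a b ∈ f

/-- The class `M` is closed under `θ`-sequences: `M^θ ⊆ M`. -/
def SeqClosed (θ : ZFSet.{u}) (M : Set ZFSet.{u}) : Prop :=
  ∀ f : ZFSet, IsFuncInto θ M f → f ∈ M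

/-- The set `M` is closed under `<κ`-sequences: `M^{<κ} ⊆ M`. -/
def SeqClosedLt (κ M : ZFSet.{u}) : Prop :=
  ∀ α : ZFSet, α ∈ κ → ∀ f : ZFSet, IsFuncInto α M.toSet f → f ∈ M

/-- `ℓ` is a partial function from `κ` to `V_κ` (coded as a set of Kuratowski pairs). -/
def IsPFun (κ ℓ : ZFSet.{u}) : Prop :=
  (∀ p ∈ ℓ, ∃ γ A : ZFSet, γ ∈ κ ∧ MemV κ A ∧ p = ZFSet.pair γ A) ∧
  ∀ γ A B : ZFSet, ZFSet.pair γ A ∈ ℓ → ZFSet.pair γ B ∈ ℓ → A = B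

/-- The set `r` is the restriction to `κ` of the class function `ℓ` (defined on the
ordinals below `κ`), coded as a set of Kuratowski pairs. -/
def RestrictEq (ℓ : ZFSet.{u} → ZFSet.{u}) (κ r : ZFSet.{u}) : Prop :=
  ∀ p : ZFSet, p ∈ r ↔ ∃ γ : ZFSet, γ ∈ κ ∧ p = ZFSet.pair γ (ℓ γ)

/-- The set `r` is the restriction to `κ` of the class function `ℓ` restricted further to
the class `D`. -/
def RestrictEqOn (ℓ : ZFSet.{u} → ZFSet.{u}) (D : Set ZFSet.{u}) (κ r : ZFSet.{u}) : Prop :=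
  ∀ p : ZFSet, p ∈ r ↔ ∃ γ : ZFSet, γ ∈ κ ∧ γ ∈ D ∧ p = ZFSet.pair γ (ℓ γ)

/-- The set `r` is the restriction to `δ` of the set partial function `ℓ`. -/
def RestrictSet (ℓ δ r : ZFSet.{u}) : Prop :=
  ∀ p : ZFSet, p ∈ r ↔ p ∈ ℓ ∧ ∃ γ A : ZFSet, γ ∈ δ ∧ p = ZFSet.pair γ A

/-! ### Supercompactness -/

/-- A `θ`-supercompactness embedding with critical point `κ`: an elementary embedding
`j : V → M` with `M` a transitive class closed under `θ`-sequences and `j(κ) > θ`. -/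
structure SCEmb (κ θ : ZFSet.{u}) where
  M : Set ZFSet.{u}
  trans : TransClass M
  e : ClassEmb V M
  crit : CritPt e.j κ
  closed : SeqClosed θ M
  big : θ ∈ e.j κ

/-- `κ` is `θ`-supercompact. -/
def SCAt (κ θ : ZFSet.{u}) : Prop := Nonempty (SCEmb κ θ)

/-- `κ` is supercompact: `θ`-supercompact for every cardinal `θ`. -/
def Supercompact (κ : ZFSet.{u}) : Prop := ∀ θ : ZFSet, IsCard θ → SCAt κ θ

/-- `ℓ` is a Laver function witnessing the Laver diamond `LD^sc_κ`. -/
def LDscFun (κ ℓ : ZFSet.{u}) : Prop :=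
  IsPFun κ ℓ ∧ ∀ θ A : ZFSet, IsCard θ → MemH θ A →
    ∃ E : SCEmb κ θ, ZFSet.pair κ A ∈ E.e.j ℓ

/-- The Laver diamond principle `LD^sc_κ`. -/
def LDsc (κ : ZFSet.{u}) : Prop := ∃ ℓ : ZFSet, LDscFun κ ℓ

/-- A universal `LD^sc` Laver function. -/
def UnivLDsc (ℓ : ZFSet.{u} → ZFSet.{u}) : Prop :=
  ∀ κ : ZFSet, Supercompact κ → ∃ r : ZFSet, RestrictEq ℓ κ r ∧ LDscFun κ r

/-! ### Strongness -/

/-- A `θ`-strongness embedding with critical point `κ`: an elementary `j : V → M` with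
`M` a transitive class and `V_θ ⊆ M`. -/
structure StrEmb (κ θ : ZFSet.{u}) where
  M : Set ZFSet.{u}
  trans : TransClass M
  e : ClassEmb V M
  crit : CritPt e.j κ
  vsub : ∀ x : ZFSet, MemV θ x → x ∈ M

/-- `κ` is `θ`-strong. -/
def StrongAt (κ θ : ZFSet.{u}) : Prop := Nonempty (StrEmb κ θ)

/-- `κ` is a strong cardinal. -/
def Strong (κ : ZFSet.{u}) : Prop := ∀ θ : ZFSet, θ.IsOrdinal → StrongAt κ θ

/-- `ℓ` witnesses the Laver diamond `LD^strong_κ`. -/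
def LDstrongFun (κ ℓ : ZFSet.{u}) : Prop :=
  IsPFun κ ℓ ∧ ∀ θ A : ZFSet, θ.IsOrdinal → MemV θ A →
    ∃ E : StrEmb κ θ, ZFSet.pair κ A ∈ E.e.j ℓ

/-- The Laver diamond principle `LD^strong_κ`. -/
def LDstrong (κ : ZFSet.{u}) : Prop := ∃ ℓ : ZFSet, LDstrongFun κ ℓ

/-- A universal `LD^strong` Laver function. -/
def UnivLDstrong (ℓ : ZFSet.{u} → ZFSet.{u}) : Prop :=
  ∀ κ : ZFSet, Strong κ → ∃ r : ZFSet, RestrictEq ℓ κ r ∧ LDstrongFun κ r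

/-! ### Measurability -/

/-- An embedding witnessing measurability of `κ`: an elementary `j : V → M`
with `M` a transitive class and critical point `κ`. -/
structure MeasEmb (κ : ZFSet.{u}) where
  M : Set ZFSet.{u}
  trans : TransClass M
  e : ClassEmb V M
  crit : CritPt e.j κ

/-- `κ` is a measurable cardinal. -/
def MeasurableCard (κ : ZFSet.{u}) : Prop := Nonempty (MeasEmb κ)

/-- `ℓ` witnesses the Laver diamond `LD^meas_κ`. -/
def LDmeasFun (κ ℓ : ZFSet.{u}) : Prop :=
  IsPFun κ ℓ ∧ ∀ A : ZFSet, MemH κ A → ∃ E : MeasEmb κ, ZFSet.pair κ A ∈ E.e.j ℓ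

/-- The Laver diamond principle `LD^meas_κ`. -/
def LDmeas (κ : ZFSet.{u}) : Prop := ∃ ℓ : ZFSet, LDmeasFun κ ℓ

/-- A universal `LD^meas` Laver function. -/
def UnivLDmeas (ℓ : ZFSet.{u} → ZFSet.{u}) : Prop :=
  ∀ κ : ZFSet, MeasurableCard κ → ∃ r : ZFSet, RestrictEq ℓ κ r ∧ LDmeasFun κ r

/-! ### Weak compactness -/

/-- `κ` is weakly compact: every transitive set `M` of size `κ` with `κ ∈ M` admits an
elementary embedding `j : M → N` into a transitive set `N` with critical point `κ`. -/
def WeaklyCompact (κ : ZFSet.{u}) : Prop :=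
  ∀ M : ZFSet, M.IsTransitive → Cardinal.mk M.toSet = Cardinal.mk κ.toSet → κ ∈ M →
    ∃ N : ZFSet, N.IsTransitive ∧ ∃ e : ClassEmb M.toSet N.toSet, CritPt e.j κ

/-- `ℓ` witnesses the Laver diamond `LD^wc_κ`. -/
def LDwcFun (κ ℓ : ZFSet.{u}) : Prop :=
  IsPFun κ ℓ ∧ ∀ A M : ZFSet, MemH κ A →
    M.IsTransitive → Cardinal.mk M.toSet = Cardinal.mk κ.toSet → κ ∈ M → A ∈ M → ℓ ∈ M →
    ∃ N : ZFSet, N.IsTransitive ∧ ∃ e : ClassEmb M.toSet N.toSet,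
      CritPt e.j κ ∧ ZFSet.pair κ A ∈ e.j ℓ

/-- The Laver diamond principle `LD^wc_κ`. -/
def LDwc (κ : ZFSet.{u}) : Prop := ∃ ℓ : ZFSet, LDwcFun κ ℓ

/-- A universal `LD^wc` Laver function. -/
def UnivLDwc (ℓ : ZFSet.{u} → ZFSet.{u}) : Prop :=
  ∀ κ : ZFSet, WeaklyCompact κ → ∃ r : ZFSet, RestrictEq ℓ κ r ∧ LDwcFun κ r

/-! ### Nice structures and unfoldability -/

/-- `M` is a nice structure for `κ`: a transitive set of size `κ`, closed under
`<κ`-sequences, with `κ ∈ M`. -/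
def Nice (κ M : ZFSet.{u}) : Prop :=
  M.IsTransitive ∧ Cardinal.mk M.toSet = Cardinal.mk κ.toSet ∧ SeqClosedLt κ M ∧ κ ∈ M

/-- `κ` is unfoldable: for every ordinal `θ`, every nice structure admits a
`θ`-unfoldability embedding. -/
def Unfoldable (κ : ZFSet.{u}) : Prop :=
  ∀ θ M : ZFSet, θ.IsOrdinal → Nice κ M →
    ∃ N : ZFSet, N.IsTransitive ∧ ∃ e : ClassEmb M.toSet N.toSet, CritPt e.j κ ∧ θ ∈ e.j κ

/-- `ℓ` witnesses the Laver diamond `LD^unf_κ`. -/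
def LDunfFun (κ ℓ : ZFSet.{u}) : Prop :=
  IsPFun κ ℓ ∧ ∀ θ A M : ZFSet, θ.IsOrdinal → MemH κ A →
    M.IsTransitive → Cardinal.mk M.toSet = Cardinal.mk κ.toSet → SeqClosedLt κ M →
    κ ∈ M → ℓ ∈ M → A ∈ M →
    ∃ N : ZFSet, N.IsTransitive ∧ ∃ e : ClassEmb M.toSet N.toSet,
      CritPt e.j κ ∧ θ ∈ e.j κ ∧ ZFSet.pair κ A ∈ e.j ℓ

/-- The Laver diamond principle `LD^unf_κ`. -/
def LDunf (κ : ZFSet.{u}) : Prop := ∃ ℓ : ZFSet, LDunfFun κ ℓ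

/-- `ℓ` witnesses the Laver diamond `LD^sunf_κ` for strong unfoldability. -/
def LDsunfFun (κ ℓ : ZFSet.{u}) : Prop :=
  IsPFun κ ℓ ∧ ∀ θ A M : ZFSet, IsCard θ → MemH θ A →
    M.IsTransitive → Cardinal.mk M.toSet = Cardinal.mk κ.toSet → SeqClosedLt κ M →
    κ ∈ M → ℓ ∈ M →
    ∃ N : ZFSet, N.IsTransitive ∧ (∀ x : ZFSet, MemV θ x → x ∈ N) ∧
      ∃ e : ClassEmb M.toSet N.toSet, CritPt e.j κ ∧ θ ∈ e.j κ ∧ ZFSet.pair κ A ∈ e.j ℓ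

/-! ### Ramsey cardinals -/

/-- `F` is a weakly amenable `M`-normal measure on `κ`. -/
def MNormalMeasure (κ M F : ZFSet.{u}) : Prop :=
  (∀ X ∈ F, X ⊆ κ ∧ X ∈ M) ∧ κ ∈ F ∧ (∅ : ZFSet) ∉ F ∧
  (∀ X Y : ZFSet, X ∈ F → Y ∈ F → X ∩ Y ∈ F) ∧
  (∀ X Y : ZFSet, X ∈ F → Y ∈ M → X ⊆ Y → Y ⊆ κ → Y ∈ F) ∧
  (∀ X : ZFSet, X ∈ M → X ⊆ κ → (X ∈ F ∨ κ \ X ∈ F)) ∧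
  (∀ ξ ∈ κ, ({ξ} : ZFSet) ∉ F) ∧
  (∀ γ f : ZFSet, γ ∈ κ → f ∈ M → IsFuncInto γ F.toSet f →
    ZFSet.sep (fun ξ => ∀ a X : ZFSet, ZFSet.pair a X ∈ f → ξ ∈ X) κ ∈ F) ∧
  (∀ f : ZFSet, f ∈ M → IsFuncInto κ F.toSet f →
    ZFSet.sep (fun ξ => ∀ a X : ZFSet, ZFSet.pair a X ∈ f → a ∈ ξ → ξ ∈ X) κ ∈ F) ∧
  (∀ D : ZFSet, D ∈ M → MemH κ D → F ∩ D ∈ M)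

/-- `j` is (isomorphic to) the ultrapower map of `M` by the `M`-measure `F` on `κ`, with
transitive (wellfounded) target `N`: `j` is elementary, has critical point `κ`, derives the
measure `F` at `κ`, and every element of `N` has the form `j(f)(κ)` for some function
`f ∈ M` with domain `κ`. -/
def IsUltrapowerMap (κ M F N : ZFSet.{u}) (j : ZFSet.{u} → ZFSet.{u}) : Prop :=
  N.IsTransitive ∧ (∃ e : ClassEmb M.toSet N.toSet, e.j = j) ∧ CritPt j κ ∧
  (∀ X : ZFSet, X ∈ M → X ⊆ κ → (X ∈ F ↔ κ ∈ j X)) ∧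
  (∀ y ∈ N, ∃ f : ZFSet, f ∈ M ∧ (∀ a ∈ κ, ∃! b : ZFSet, ZFSet.pair a b ∈ f) ∧
    ZFSet.pair κ y ∈ j f)

/-- A wellfounded iteration of `⟨M, F⟩` of length `δ`: a commuting system of elementary
embeddings between transitive models, starting at `⟨M, F⟩`, taking ultrapowers by the
image measures at successor steps and direct limits at limit stages. -/
structure Iteration (κ M F δ : ZFSet.{u}) where
  Mod : ZFSet.{u} → ZFSet.{u}
  Meas : ZFSet.{u} → ZFSet.{u}
  cp : ZFSet.{u} → ZFSet.{u}
  emb : ZFSet.{u} → ZFSet.{u} → ZFSet.{u} → ZFSet.{u}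
  mod_zero : Mod ∅ = M
  meas_zero : Meas ∅ = F
  cp_zero : cp ∅ = κ
  trans' : ∀ i : ZFSet, i ∈ δ → (Mod i).IsTransitive
  elem' : ∀ i k : ZFSet, i ∈ δ → k ∈ δ → i ∈ k →
    ∃ e : ClassEmb (Mod i).toSet (Mod k).toSet, e.j = emb i k
  comm : ∀ i k l : ZFSet, i ∈ δ → k ∈ δ → l ∈ δ → i ∈ k → k ∈ l →
    ∀ x ∈ Mod i, emb k l (emb i k x) = emb i l x
  cp_emb : ∀ i : ZFSet, i ∈ δ → i ≠ ∅ → cp i = emb ∅ i κ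
  succ' : ∀ i : ZFSet, i ∈ δ → insert i i ∈ δ →
    IsUltrapowerMap (cp i) (Mod i) (Meas i) (Mod (insert i i)) (emb i (insert i i)) ∧
    (∀ Y : ZFSet, Y ∈ Meas (insert i i) ↔
      ∃ D : ZFSet, D ∈ Mod i ∧ Y ∈ emb i (insert i i) (Meas i ∩ D))
  limit' : ∀ l : ZFSet, l ∈ δ → l ≠ ∅ → (∀ i ∈ l, insert i i ∈ l) →
    (∀ y ∈ Mod l, ∃ i : ZFSet, i ∈ l ∧ ∃ x, x ∈ Mod i ∧ emb i l x = y) ∧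
    (∀ Y : ZFSet, Y ∈ Meas l ↔
      ∃ i : ZFSet, i ∈ l ∧ ∃ D, D ∈ Mod i ∧ Y ∈ emb i l (Meas i ∩ D))

/-- `⟨M, F⟩` is iterable: all its iterations (of any ordinal length) are wellfounded,
i.e. realized by transitive models. -/
def Iterable (κ M F : ZFSet.{u}) : Prop :=
  ∀ δ : ZFSet, δ.IsOrdinal → Nonempty (Iteration κ M F δ)

/-! ### Constructibility -/

/-- `X` is a subset of `M` definable over `⟨M, ∈⟩` with parameters. -/
def DefinableSubset (M X : ZFSet.{u}) : Prop :=
  X ⊆ M ∧ ∃ (n : ℕ) (φ : SetLang.Formula (Fin (n + 1))) (v : Fin n → ZFSet.{u})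
    (hv : ∀ i, v i ∈ M.toSet),
    ∀ a : ZFSet, a ∈ X ↔ ∃ ha : a ∈ M.toSet,
      φ.Realize (Fin.cons (⟨a, ha⟩ : M.toSet) (fun i => (⟨v i, hv i⟩ : M.toSet)))

/-- The set of all subsets of `M` definable over `⟨M, ∈⟩` with parameters. -/
noncomputable def DefSet (M : ZFSet.{u}) : ZFSet.{u} :=
  ZFSet.sep (fun X => DefinableSubset M X) (ZFSet.powerset M)

/-- `h` codes the constructible hierarchy up to `δ`: a function with domain `δ` such that
`h(β) = ⋃_{γ<β} Def(h(γ))` for every `β < δ`. -/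
def IsLHierarchy (δ h : ZFSet.{u}) : Prop :=
  δ.IsOrdinal ∧
  (∀ p ∈ h, ∃ β y : ZFSet, β ∈ δ ∧ p = ZFSet.pair β y) ∧
  (∀ β ∈ δ, ∃! y : ZFSet, ZFSet.pair β y ∈ h) ∧
  ∀ β y : ZFSet, ZFSet.pair β y ∈ h →
    ∀ z : ZFSet, z ∈ y ↔ ∃ γ x : ZFSet, γ ∈ β ∧ ZFSet.pair γ x ∈ h ∧ z ∈ DefSet x

/-- `x` is constructible: it appears at some level of some constructible hierarchy. -/
def Constructible (x : ZFSet.{u}) : Prop :=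
  ∃ δ h β y : ZFSet, IsLHierarchy δ h ∧ ZFSet.pair β y ∈ h ∧ x ∈ y

/-- The axiom of constructibility `V = L`. -/
def VeqL : Prop := ∀ x : ZFSet.{u}, Constructible x

/-! ### Normal measures -/

/-- `U` is a normal measure on `κ`: a `κ`-complete nonprincipal ultrafilter on `κ`
closed under diagonal intersections. -/
def IsNormalMeasure (κ U : ZFSet.{u}) : Prop :=
  (∀ X ∈ U, X ⊆ κ) ∧ κ ∈ U ∧ (∅ : ZFSet) ∉ U ∧
  (∀ X Y : ZFSet, X ∈ U → Y ∈ U → X ∩ Y ∈ U) ∧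
  (∀ X Y : ZFSet, X ∈ U → X ⊆ Y → Y ⊆ κ → Y ∈ U) ∧
  (∀ X : ZFSet, X ⊆ κ → (X ∈ U ∨ κ \ X ∈ U)) ∧
  (∀ ξ ∈ κ, ({ξ} : ZFSet) ∉ U) ∧
  (∀ γ f : ZFSet, γ ∈ κ → IsFuncInto γ U.toSet f →
    ZFSet.sep (fun ξ => ∀ a X : ZFSet, ZFSet.pair a X ∈ f → ξ ∈ X) κ ∈ U) ∧
  (∀ f : ZFSet, IsFuncInto κ U.toSet f →
    ZFSet.sep (fun ξ => ∀ a X : ZFSet, ZFSet.pair a X ∈ f → a ∈ ξ → ξ ∈ X) κ ∈ U)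

end LaverDiamond

namespace LaverDiamond

/-- `R` is defined by one first-order formula, uniformly over all transitive classes. -/
class Dfn {α : Type} (R : Set ZFSet.{u} → (α → ZFSet.{u}) → Prop) : Prop where
  out : ∃ φ : SetLang.Formula α, ∀ M : Set ZFSet.{u}, TransClass M →
    ∀ v : α → M, φ.Realize v ↔ R M (fun a => v a)

theorem Dfn.congr {α : Type} {R S : Set ZFSet.{u} → (α → ZFSet.{u}) → Prop} [h : Dfn R]
    (e : ∀ M, TransClass M → ∀ v : α → ZFSet.{u}, (∀ a, v a ∈ M) → (R M v ↔ S M v)) : Dfn S := by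
  obtain ⟨φ, hφ⟩ := h.out
  exact ⟨φ, fun M hM v => (hφ M hM v).trans (e M hM _ fun a => (v a).2)⟩

theorem Dfn.relabel {α β : Type} {R : Set ZFSet.{u} → (α → ZFSet.{u}) → Prop} [h : Dfn R]
    (g : α → β) : Dfn fun M v => R M (fun a => v (g a)) := by
  obtain ⟨φ, hφ⟩ := h.out
  exact ⟨Language.Formula.relabel g φ, fun M hM v => by
    rw [Language.Formula.realize_relabel, hφ M hM]; rfl⟩

section closure
variable {α : Type}

instance Dfn.mem (a b : α) : Dfn.{u} fun _ v => v a ∈ v b :=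
  ⟨Language.Relations.formula₂ (L := SetLang) memRel.mem (.var a) (.var b),
    fun _ _ _ => Language.Formula.realize_rel₂⟩

instance Dfn.eq (a b : α) : Dfn.{u} fun _ v => v a = v b :=
  ⟨Language.Term.equal (.var a) (.var b), fun _ _ v => by
    simp [Language.Formula.realize_equal, Subtype.ext_iff]⟩

variable {R S : Set ZFSet.{u} → (α → ZFSet.{u}) → Prop}

instance Dfn.not [h : Dfn R] : Dfn fun M v => ¬ R M v := by
  obtain ⟨φ, hφ⟩ := h.out
  exact ⟨∼φ, fun M hM v => by rw [Language.Formula.realize_not, hφ M hM]⟩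

instance Dfn.imp [h : Dfn R] [h' : Dfn S] : Dfn fun M v => R M v → S M v := by
  obtain ⟨φ, hφ⟩ := h.out
  obtain ⟨ψ, hψ⟩ := h'.out
  exact ⟨φ.imp ψ, fun M hM v => by rw [Language.Formula.realize_imp, hφ M hM, hψ M hM]⟩

instance Dfn.and [Dfn R] [Dfn S] : Dfn fun M v => R M v ∧ S M v :=
  Dfn.congr (R := fun M v => ¬ (R M v → ¬ S M v)) fun _ _ _ _ => by tauto

instance Dfn.or [Dfn R] [Dfn S] : Dfn fun M v => R M v ∨ S M v :=
  Dfn.congr (R := fun M v => ¬ R M v → S M v) fun _ _ _ _ => by tauto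

instance Dfn.iff [Dfn R] [Dfn S] : Dfn fun M v => (R M v ↔ S M v) :=
  Dfn.congr (R := fun M v => (R M v → S M v) ∧ (S M v → R M v)) fun _ _ _ _ => by tauto

variable {P : Set ZFSet.{u} → (α → ZFSet.{u}) → ZFSet.{u} → Prop}

instance Dfn.ex [h : Dfn (α := Option α) fun M v => P M (fun a => v (some a)) (v none)] :
    Dfn fun M v => ∃ x ∈ M, P M v x := by
  obtain ⟨φ, hφ⟩ := h.out
  refine ⟨Language.Formula.iExs Unit
    (φ.relabel fun o => o.elim (Sum.inr ()) Sum.inl), fun M hM v => ?_⟩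
  rw [Language.Formula.realize_iExs]
  simp only [Language.Formula.realize_relabel, hφ M hM]
  constructor
  · rintro ⟨i, hi⟩
    exact ⟨i (), (i ()).2, hi⟩
  · rintro ⟨x, hx, hi⟩
    exact ⟨fun _ => ⟨x, hx⟩, hi⟩

instance Dfn.all [Dfn (α := Option α) fun M v => P M (fun a => v (some a)) (v none)] :
    Dfn fun M v => ∀ x ∈ M, P M v x :=
  Dfn.congr (R := fun M v => ¬ ∃ x ∈ M, ¬ P M v x) fun _ _ _ _ => by push Not; rfl

/-- Quantification over all sets, when it is implicitly bounded. -/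
theorem Dfn.exOf [Dfn (α := Option α) fun M v => P M (fun a => v (some a)) (v none)]
    (h : ∀ M, TransClass M → ∀ v : α → ZFSet.{u}, (∀ a, v a ∈ M) → ∀ x, P M v x → x ∈ M) :
    Dfn fun M v => ∃ x, P M v x :=
  Dfn.congr (R := fun M v => ∃ x ∈ M, P M v x) fun M hM v hv =>
    ⟨fun ⟨x, _, h⟩ => ⟨x, h⟩, fun ⟨x, hx⟩ => ⟨x, h M hM v hv x hx, hx⟩⟩

instance Dfn.exMem (b : α) [Dfn (α := Option α) fun M v => P M (fun a => v (some a)) (v none)] :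
    Dfn fun M v => ∃ x ∈ v b, P M v x :=
  Dfn.exOf fun _ hM _ hv _ hx => hM _ (hv b) _ hx.1

instance Dfn.allMem (b : α) [Dfn (α := Option α) fun M v => P M (fun a => v (some a)) (v none)] :
    Dfn fun M v => ∀ x ∈ v b, P M v x :=
  Dfn.congr (R := fun M v => ¬ ∃ x ∈ v b, ¬ P M v x) fun _ _ _ _ => by push Not; rfl

instance Dfn.eqUpair (a b c : α) : Dfn.{u} fun _ v => v a = {v b, v c} :=
  Dfn.congr (R := fun _ v => (∀ x ∈ v a, x = v b ∨ x = v c) ∧ v b ∈ v a ∧ v c ∈ v a)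
    fun _ _ v _ => by
      constructor
      · rintro ⟨h1, h2, h3⟩
        ext z
        rw [ZFSet.mem_pair]
        exact ⟨h1 z, by rintro (rfl | rfl) <;> assumption⟩
      · intro h
        simp [h]

instance Dfn.eqPair (a b c : α) : Dfn.{u} fun _ v => v a = ZFSet.pair (v b) (v c) :=
  Dfn.congr (R := fun _ v => (∀ x ∈ v a, x = {v b, v b} ∨ x = {v b, v c}) ∧
      (∃ x ∈ v a, x = {v b, v b}) ∧ ∃ x ∈ v a, x = {v b, v c})
    fun _ _ v _ => by
      constructor
      · rintro ⟨h1, ⟨_, h2, rfl⟩, _, h3, rfl⟩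
        ext z
        rw [ZFSet.pair, ← ZFSet.pair_eq_singleton (v b), ZFSet.mem_pair]
        exact ⟨h1 z, by rintro (rfl | rfl) <;> assumption⟩
      · intro h
        simp [h, ZFSet.pair]

end closure

theorem TransClass.of_pair {M : Set ZFSet.{u}} (hM : TransClass M) {a b : ZFSet.{u}}
    (h : ZFSet.pair a b ∈ M) : a ∈ M ∧ b ∈ M := by
  have h' : ({a, b} : ZFSet) ∈ M := hM _ h _ (by simp [ZFSet.pair])
  exact ⟨hM _ h' _ (by simp), hM _ h' _ (by simp)⟩

instance Dfn.pairMem {α : Type} (a b c : α) : Dfn.{u} fun _ v => ZFSet.pair (v a) (v b) ∈ v c :=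
  Dfn.congr (R := fun _ v => ∃ p ∈ v c, p = ZFSet.pair (v a) (v b)) fun _ _ v _ => by simp

section pairs
variable {α : Type} {P : Set ZFSet.{u} → (α → ZFSet.{u}) → ZFSet.{u} → Prop}
  {Q : Set ZFSet.{u} → (α → ZFSet.{u}) → ZFSet.{u} → ZFSet.{u} → Prop}

instance Dfn.exPairLeft (a b : α)
    [Dfn (α := Option α) fun M v => P M (fun a => v (some a)) (v none)] :
    Dfn fun M v => ∃ x, ZFSet.pair x (v a) ∈ v b ∧ P M v x :=
  Dfn.exOf fun _ hM _ hv _ hx => (hM.of_pair (hM _ (hv b) _ hx.1)).1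

instance Dfn.exPairRight (a b : α)
    [Dfn (α := Option α) fun M v => P M (fun a => v (some a)) (v none)] :
    Dfn fun M v => ∃ x, ZFSet.pair (v a) x ∈ v b ∧ P M v x :=
  Dfn.exOf fun _ hM _ hv _ hx => (hM.of_pair (hM _ (hv b) _ hx.1)).2

instance Dfn.exPairLeftMem (a b : α) : Dfn.{u} fun _ v => ∃ x, ZFSet.pair x (v a) ∈ v b :=
  Dfn.congr (R := fun _ v => ∃ x, ZFSet.pair x (v a) ∈ v b ∧ ZFSet.pair x (v a) ∈ v b)
    fun _ _ _ _ => by simp only [and_self]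

instance Dfn.exPairRightMem (a b : α) : Dfn.{u} fun _ v => ∃ x, ZFSet.pair (v a) x ∈ v b :=
  Dfn.congr (R := fun _ v => ∃ x, ZFSet.pair (v a) x ∈ v b ∧ ZFSet.pair (v a) x ∈ v b)
    fun _ _ _ _ => by simp only [and_self]

instance Dfn.exEqPair (a : α) [h : Dfn (α := Option (Option α))
      fun M v => Q M (fun a => v (some (some a))) (v (some none)) (v none)] :
    Dfn fun M v => ∃ x y, v a = ZFSet.pair x y ∧ Q M v x y :=
  Dfn.congr (R := fun M v => ∃ x ∈ M, ∃ y ∈ M, v a = ZFSet.pair x y ∧ Q M v x y)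
    fun M hM v hv => by
      constructor
      · rintro ⟨x, _, y, _, h⟩
        exact ⟨x, y, h⟩
      · rintro ⟨x, y, h⟩
        have := hM.of_pair (h.1 ▸ hv a)
        exact ⟨x, this.1, y, this.2, h⟩

instance Dfn.allPairMem (a : α) [h : Dfn (α := Option (Option α))
      fun M v => Q M (fun a => v (some (some a))) (v (some none)) (v none)] :
    Dfn fun M v => ∀ x y, ZFSet.pair x y ∈ v a → Q M v x y :=
  Dfn.congr (R := fun M v => ∀ x ∈ M, ∀ y ∈ M, ZFSet.pair x y ∈ v a → Q M v x y)
    fun M hM v hv => by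
      constructor
      · intro h x y hxy
        have := hM.of_pair (hM _ (hv a) _ hxy)
        exact h x this.1 y this.2 hxy
      · intro h x _ y _
        exact h x y

end pairs

/-- `i = ⟨f, γ⟩` with `b ∈ γ`. -/
def Below (i b : ZFSet.{u}) : Prop := ∃ f γ, i = ZFSet.pair f γ ∧ b ∈ γ

/-- `i = ⟨f, γ⟩` with `b` in the range of `f`. -/
def InRan (i b : ZFSet.{u}) : Prop :=
  ∃ f γ, i = ZFSet.pair f γ ∧ ∃ a, ZFSet.pair a b ∈ f

/-- `i = ⟨f, γ⟩` where `γ ∈ κ` and `f` is an order embedding into `τ` of an ordinal below `κ`. -/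
def Idx (κ τ i : ZFSet.{u}) : Prop :=
  ∃ f γ, i = ZFSet.pair f γ ∧ γ ∈ κ ∧ ∃ δ ∈ κ,
    (∀ p ∈ f, ∃ a ∈ δ, ∃ b ∈ τ, p = ZFSet.pair a b) ∧
    (∀ a ∈ δ, ∃ b ∈ τ, ZFSet.pair a b ∈ f) ∧
    ∀ a ∈ δ, ∀ a' ∈ δ, ∀ b ∈ τ, ∀ b' ∈ τ, ZFSet.pair a b ∈ f → ZFSet.pair a' b' ∈ f →
      (a ∈ a' ↔ b ∈ b') ∧ (a = a' ↔ b = b')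

/-- `p` holds almost everywhere with respect to `U`. -/
def Ev (U : ZFSet.{u}) (p : ZFSet.{u} → Prop) : Prop := ∃ X ∈ U, ∀ i ∈ X, p i

/-- In the class `M`, the set `U` generates a normal fine measure on the indices `Idx κ τ`. -/
def Good (M : Set ZFSet.{u}) (κ τ U : ZFSet.{u}) : Prop :=
  (∀ X ∈ U, (∃ i ∈ X, Idx κ τ i) ∧ ∀ i ∈ X, Idx κ τ i) ∧
  (∀ X ∈ U, ∀ Y ∈ U, Ev U fun i => i ∈ X ∧ i ∈ Y) ∧
  (∀ X ∈ M, (Ev U fun i => i ∈ X) ∨ Ev U fun i => i ∉ X) ∧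
  (∀ b ∈ κ, Ev U fun i => Below i b) ∧
  (∀ b ∈ τ, Ev U fun i => InRan i b) ∧
  (∀ F ∈ M, (Ev U fun i => ∃ b, ZFSet.pair i b ∈ F ∧ Below i b) →
    ∃ b ∈ κ, Ev U fun i => ZFSet.pair i b ∈ F) ∧
  ∀ F ∈ M, (Ev U fun i => ∃ b, ZFSet.pair i b ∈ F ∧ InRan i b) →
    ∃ b ∈ τ, Ev U fun i => ZFSet.pair i b ∈ F

/-- `x` lies in the image under `e` of the range of the function part of `i`. -/
def Sig (i e x : ZFSet.{u}) : Prop := ∃ b, ZFSet.pair b x ∈ e ∧ InRan i b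

/-- `c` is a partial collapsing map relative to `Sig i e`. -/
def Coll (i e c : ZFSet.{u}) : Prop :=
  ∀ x y, ZFSet.pair x y ∈ c →
    (∀ z ∈ y, ∃ w ∈ x, Sig i e w ∧ ZFSet.pair w z ∈ c) ∧
    ∀ w ∈ x, Sig i e w → ∃ z ∈ y, ZFSet.pair w z ∈ c

/-- In the class `M`, for `U`-almost all `i = ⟨f, γ⟩`, the value of `ℓ` at `γ` is the image
of `A` under the collapse relative to `Sig i e`. -/
def Guess (M : Set ZFSet.{u}) (U e A ℓ : ZFSet.{u}) : Prop :=
  Ev U fun i => ∃ c ∈ M, Coll i e c ∧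
    ∃ f γ, i = ZFSet.pair f γ ∧ ∃ y, ZFSet.pair A y ∈ c ∧ ZFSet.pair γ y ∈ ℓ

/-- `e` is a map from `τ` onto a transitive set containing `A`. -/
def Code (τ e A : ZFSet.{u}) : Prop :=
  (∀ p ∈ e, ∃ a x, p = ZFSet.pair a x ∧ a ∈ τ) ∧
  (∀ a ∈ τ, ∃ x, ZFSet.pair a x ∈ e) ∧
  (∀ a x, ZFSet.pair a x ∈ e → ∀ b y, ZFSet.pair b y ∈ e → a = b → x = y) ∧
  (∀ a x, ZFSet.pair a x ∈ e → ∀ y ∈ x, ∃ b, ZFSet.pair b y ∈ e ∧ b ∈ τ) ∧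
  ∃ a ∈ τ, ZFSet.pair a A ∈ e

/-- In the class `M`, some code of `A` on `τ` is not guessed by `ℓ` at `κ`. -/
def Bad (M : Set ZFSet.{u}) (κ τ A ℓ : ZFSet.{u}) : Prop :=
  ∃ e ∈ M, Code τ e A ∧ ¬ ∃ U ∈ M, Good M κ τ U ∧ Guess M U e A ℓ

/-- In the class `M`, `ℓ` picks at each `γ ∈ κ` a failure with least possible `τ`. -/
def Picks (M : Set ZFSet.{u}) (κ ℓ : ZFSet.{u}) : Prop :=
  ∀ γ ∈ κ, (∃ τ ∈ κ, ∃ A ∈ M, Bad M γ τ A ℓ) →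
    ∃ τ ∈ κ, (∃ A ∈ M, ZFSet.pair γ A ∈ ℓ ∧ Bad M γ τ A ℓ) ∧
      ∀ τ' ∈ τ, ∀ A ∈ M, ¬ Bad M γ τ' A ℓ

section instances
variable {α : Type}

instance (i b : α) : Dfn.{u} fun _ v => Below (v i) (v b) := by unfold Below; infer_instance

instance (i b : α) : Dfn.{u} fun _ v => InRan (v i) (v b) := by unfold InRan; infer_instance

instance (κ τ i : α) : Dfn.{u} fun _ v => Idx (v κ) (v τ) (v i) := by unfold Idx; infer_instance

instance (U : α) {P : Set ZFSet.{u} → (α → ZFSet.{u}) → ZFSet.{u} → Prop}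
    [Dfn (α := Option α) fun M v => P M (fun a => v (some a)) (v none)] :
    Dfn fun M v => Ev (v U) (P M v) := by
  have : Dfn (α := Option (Option α)) fun M v => P M (fun a => v (some (some a))) (v none) :=
    Dfn.relabel (R := fun M v => P M (fun a => v (some a)) (v none)) (Option.map some)
  unfold Ev
  infer_instance

instance (i e x : α) : Dfn.{u} fun _ v => Sig (v i) (v e) (v x) := by unfold Sig; infer_instance

instance (i e c : α) : Dfn.{u} fun _ v => Coll (v i) (v e) (v c) := by unfold Coll; infer_instance

instance (κ τ U : α) : Dfn.{u} fun M v => Good M (v κ) (v τ) (v U) := by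
  unfold Good; infer_instance

instance (U e A ℓ : α) : Dfn.{u} fun M v => Guess M (v U) (v e) (v A) (v ℓ) := by
  unfold Guess; infer_instance

instance (τ e A : α) : Dfn.{u} fun _ v => Code (v τ) (v e) (v A) := by unfold Code; infer_instance

instance (κ τ A ℓ : α) : Dfn.{u} fun M v => Bad M (v κ) (v τ) (v A) (v ℓ) := by
  unfold Bad; infer_instance

instance (κ ℓ : α) : Dfn.{u} fun M v => Picks M (v κ) (v ℓ) := by unfold Picks; infer_instance

end instances

/-- The Mostowski collapse of a set-like, well-founded and extensional relation. -/
theorem exists_collapse {Q : Type (u + 1)} (E : Q → Q → Prop) (wf : WellFounded E)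
    (small : ∀ p, Small.{u} {q // E q p}) (ext : ∀ p q, (∀ r, E r p ↔ E r q) → p = q) :
    ∃ π : Q → ZFSet.{u}, Function.Injective π ∧ ∀ p y, y ∈ π p ↔ ∃ q, E q p ∧ π q = y := by
  let π : Q → ZFSet.{u} := wf.fix fun p ih =>
    haveI := small p
    ZFSet.range fun q : {q // E q p} => ih q.1 q.2
  have hπ : ∀ p y, y ∈ π p ↔ ∃ q, E q p ∧ π q = y := by
    intro p y
    have := small p
    rw [show π p = ZFSet.range fun q : {q // E q p} => π q.1 from wf.fix_eq _ p]
    simp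
  refine ⟨π, fun p => ?_, hπ⟩
  induction p using wf.induction with
  | _ p ih =>
    intro q h
    refine ext p q fun r => ⟨fun hr => ?_, fun hr => ?_⟩
    · obtain ⟨r', hr', e⟩ := (hπ q _).1 (h ▸ (hπ p _).2 ⟨r, hr, rfl⟩)
      rwa [ih r hr e.symm]
    · obtain ⟨r', hr', e⟩ := (hπ p _).1 (h ▸ (hπ q _).2 ⟨r, hr, rfl⟩)
      rwa [← ih r' hr' e]

section ultrapower

open Filter

/-- The ultrapower of the universe by an ultrafilter on the class of all sets. -/
abbrev Ult (U : Ultrafilter ZFSet.{u}) : Type (u + 1) :=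
  (U : Filter ZFSet.{u}).Product fun _ => ((V.{u} : Set ZFSet.{u}) : Type (u + 1))

variable {U : Ultrafilter ZFSet.{u}}

/-- The class of a function in the ultrapower. -/
def Ult.mk (F : ZFSet.{u} → ZFSet.{u}) : Ult U :=
  ((fun i => ⟨F i, Set.mem_univ _⟩ : ZFSet.{u} → (V.{u} : Set ZFSet.{u})) : Ult U)

instance : Nonempty (V.{u} : Set ZFSet.{u}) := ⟨⟨∅, Set.mem_univ _⟩⟩

theorem Ult.exists_mk (q : Ult U) : ∃ F, Ult.mk F = q := by
  induction q using Quotient.inductionOn with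
  | _ f => exact ⟨fun i => (f i).1, rfl⟩

theorem Ult.realize_mk {α : Type} (φ : SetLang.Formula α) (x : α → ZFSet.{u} → ZFSet.{u}) :
    φ.Realize (fun a => (Ult.mk (x a) : Ult U)) ↔
      ∀ᶠ i in U, φ.Realize fun a => (⟨x a i, Set.mem_univ _⟩ : (V.{u} : Set ZFSet.{u})) :=
  Language.Ultraproduct.realize_formula_cast φ _

theorem Ult.mk_eq {F G : ZFSet.{u} → ZFSet.{u}} :
    (Ult.mk F : Ult U) = Ult.mk G ↔ ∀ᶠ i in U, F i = G i := by
  refine Quotient.eq''.trans (eventually_congr (Eventually.of_forall fun i => ?_))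
  exact Subtype.mk_eq_mk

/-- The membership relation of the ultrapower. -/
def Ult.E (p q : Ult U) : Prop :=
  Language.Structure.RelMap (L := SetLang) memRel.mem ![p, q]

theorem Ult.E_mk {F G : ZFSet.{u} → ZFSet.{u}} :
    Ult.E (Ult.mk F : Ult U) (Ult.mk G) ↔ ∀ᶠ i in U, F i ∈ G i := by
  let φ := Language.Relations.formula₂ (L := SetLang) memRel.mem (.var (0 : Fin 2)) (.var 1)
  have h1 : φ.Realize (fun a => (Ult.mk (![F, G] a) : Ult U)) ↔
      Ult.E (Ult.mk F : Ult U) (Ult.mk G) := Language.Formula.realize_rel₂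
  have h2 : ∀ i, (φ.Realize fun a => (⟨![F, G] a i, Set.mem_univ _⟩ : (V.{u} : Set ZFSet.{u}))) ↔
      F i ∈ G i := fun i => Language.Formula.realize_rel₂
  rw [← h1, Ult.realize_mk]
  simp only [h2]

theorem Ult.wf (hω : ∀ F : ZFSet.{u} → ℕ, ∃ n, ∀ᶠ i in U, F i = n) :
    WellFounded (Ult.E (U := U)) := by
  rw [wellFounded_iff_isEmpty_descending_chain]
  refine ⟨fun ⟨q, hq⟩ => ?_⟩
  choose F hF using fun n => (q n).exists_mk
  have hE : ∀ n, ∀ᶠ i in U, F (n + 1) i ∈ F n i := fun n => by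
    rw [← Ult.E_mk, hF, hF]
    exact hq n
  have hex : ∀ i, ∃ n, F (n + 1) i ∉ F n i := fun i => by
    by_contra! h
    exact (wellFounded_iff_isEmpty_descending_chain.1 ZFSet.mem_wf).false ⟨fun n => F n i, h⟩
  choose N hN using hex
  obtain ⟨n, hn⟩ := hω N
  obtain ⟨i, hi, hi'⟩ := (hn.and (hE n)).exists
  exact hN i (hi ▸ hi')

theorem Ult.ext (p q : Ult U) (h : ∀ r, Ult.E r p ↔ Ult.E r q) : p = q := by
  have key : ∀ F G : ZFSet.{u} → ZFSet.{u},
      (∀ r : Ult U, Ult.E r (Ult.mk F) → Ult.E r (Ult.mk G)) → ∀ᶠ i in U, F i ⊆ G i := by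
    intro F G h
    classical
    let H : ZFSet.{u} → ZFSet.{u} := fun i =>
      if hi : ∃ x ∈ F i, x ∉ G i then hi.choose else ∅
    by_contra hn
    rw [← Ultrafilter.eventually_not] at hn
    have hH : ∀ᶠ i in U, H i ∈ F i ∧ H i ∉ G i := hn.mono fun i hi => by
      have hi : ∃ x ∈ F i, x ∉ G i := by simpa [ZFSet.subset_def] using hi
      simp only [H, dif_pos hi]
      exact hi.choose_spec
    obtain ⟨i, h1, h2⟩ :=
      (hH.and (Ult.E_mk.1 (h _ (Ult.E_mk.2 (hH.mono fun _ => And.left))))).exists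
    exact h1.2 h2
  obtain ⟨F, rfl⟩ := p.exists_mk
  obtain ⟨G, rfl⟩ := q.exists_mk
  refine Ult.mk_eq.2 ?_
  filter_upwards [key F G fun r => (h r).1, key G F fun r => (h r).2] with i h1 h2
  exact ZFSet.ext fun z => ⟨@h1 z, @h2 z⟩

theorem Ult.small {S : ZFSet.{u}} (hS : ∀ᶠ i in U, i ∈ S) (p : Ult U) :
    Small.{u} {q // Ult.E q p} := by
  classical
  obtain ⟨G, rfl⟩ := p.exists_mk
  let f : (∀ i : {i // i ∈ S}, {x // x ∈ insert ∅ (G i)}) → Ult U := fun x =>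
    Ult.mk fun i => if h : i ∈ S then (x ⟨i, h⟩).1 else ∅
  have : Small.{u} (Set.range f) := _root_.small_range f
  suffices h : {q | Ult.E q (Ult.mk G)} ⊆ Set.range f from small_subset h
  intro q hq
  obtain ⟨F, rfl⟩ := q.exists_mk
  have hq : ∀ᶠ i in U, F i ∈ G i := Ult.E_mk.1 hq
  refine ⟨fun i => if h : F i ∈ G i then ⟨F i, by simp [h]⟩ else ⟨∅, by simp⟩,
    Ult.mk_eq.2 ?_⟩
  filter_upwards [hq, hS] with i h1 h2
  simp [h1, h2]

/-- The transitive collapse of the ultrapower of the universe, with Łoś's theorem. -/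
theorem exists_ultrapower {S : ZFSet.{u}} (hS : ∀ᶠ i in U, i ∈ S)
    (hω : ∀ F : ZFSet.{u} → ℕ, ∃ n, ∀ᶠ i in U, F i = n) :
    ∃ cls : (ZFSet.{u} → ZFSet.{u}) → ZFSet.{u},
      (∀ F G, cls F = cls G ↔ ∀ᶠ i in U, F i = G i) ∧
      (∀ G y, y ∈ cls G ↔ ∃ F, (∀ᶠ i in U, F i ∈ G i) ∧ cls F = y) ∧
      ∀ {α : Type} (φ : SetLang.Formula α) (x : α → ZFSet.{u} → ZFSet.{u}),
        φ.Realize (fun a => (⟨cls (x a), Set.mem_range_self _⟩ : Set.range cls)) ↔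
          ∀ᶠ i in U, φ.Realize fun a => (⟨x a i, Set.mem_univ _⟩ : (V.{u} : Set ZFSet.{u})) := by
  obtain ⟨π, inj, hπ⟩ := exists_collapse (Ult.E (U := U)) (Ult.wf hω) (Ult.small hS) Ult.ext
  refine ⟨fun F => π (Ult.mk F), fun F G => inj.eq_iff.trans Ult.mk_eq, fun G y => ?_, ?_⟩
  · rw [hπ]
    constructor
    · rintro ⟨q, hq, rfl⟩
      obtain ⟨F, rfl⟩ := q.exists_mk
      exact ⟨F, Ult.E_mk.1 hq, rfl⟩
    · rintro ⟨F, hF, rfl⟩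
      exact ⟨_, Ult.E_mk.2 hF, rfl⟩
  · intro α φ x
    rw [← Ult.realize_mk]
    let N : Set ZFSet.{u} := Set.range fun F => π (Ult.mk F)
    let f : Ult U → N := fun q => ⟨π q, by obtain ⟨F, rfl⟩ := q.exists_mk; exact ⟨F, rfl⟩⟩
    have hf : Function.Bijective f := by
      refine ⟨fun p q h => inj (congrArg Subtype.val h), ?_⟩
      rintro ⟨_, F, rfl⟩
      exact ⟨Ult.mk F, rfl⟩
    have hE : ∀ p q : Ult U, π p ∈ π q ↔ Ult.E p q := fun p q => by
      rw [hπ]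
      exact ⟨fun ⟨r, hr, e⟩ => inj e ▸ hr, fun h => ⟨p, h, rfl⟩⟩
    let g : Ult U ≃[SetLang] N :=
      { Equiv.ofBijective f hf with
        map_fun' := fun f _ => f.elim
        map_rel' := by
          rintro _ ⟨⟩ x
          refine (hE (x 0) (x 1)).trans (iff_of_eq ?_)
          unfold Ult.E
          congr 1
          funext i
          fin_cases i <;> rfl }
    exact Language.StrongHomClass.realize_formula g φ

end ultrapower

/-- The image of a set under a class function. -/
noncomputable def img (f : ZFSet.{u} → ZFSet.{u}) (d : ZFSet.{u}) : ZFSet.{u} :=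
  ZFSet.range fun x : {x // x ∈ d} => f x

theorem mem_img {f : ZFSet.{u} → ZFSet.{u}} {d y : ZFSet.{u}} :
    y ∈ img f d ↔ ∃ x ∈ d, f x = y := by
  simp [img]

/-- The restriction of a class function to a set. -/
noncomputable def graph (f : ZFSet.{u} → ZFSet.{u}) (d : ZFSet.{u}) : ZFSet.{u} :=
  img (fun x => ZFSet.pair x (f x)) d

theorem pair_mem_graph {f : ZFSet.{u} → ZFSet.{u}} {d a b : ZFSet.{u}} :
    ZFSet.pair a b ∈ graph f d ↔ a ∈ d ∧ f a = b := by
  simp only [graph, mem_img, ZFSet.pair_inj]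
  constructor
  · rintro ⟨_, h, rfl, rfl⟩
    exact ⟨h, rfl⟩
  · rintro ⟨h, rfl⟩
    exact ⟨a, h, rfl, rfl⟩

/-- The transitive collapse relative to the class `S`. -/
noncomputable def col (S : ZFSet.{u} → Prop) : ZFSet.{u} → ZFSet.{u} :=
  ZFSet.mem_wf.fix fun x ih => ZFSet.range fun w : {w // w ∈ ZFSet.sep S x} =>
    ih w.1 (ZFSet.mem_sep.1 w.2).1

theorem mem_col {S : ZFSet.{u} → Prop} {x z : ZFSet.{u}} :
    z ∈ col S x ↔ ∃ w ∈ x, S w ∧ col S w = z := by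
  rw [show col S x = ZFSet.range fun w : {w // w ∈ ZFSet.sep S x} => col S w from
    ZFSet.mem_wf.fix_eq _ x]
  simp [and_assoc]

theorem Coll.eq_col {i e c : ZFSet.{u}} (h : Coll i e c) {x y : ZFSet.{u}}
    (hxy : ZFSet.pair x y ∈ c) : y = col (Sig i e) x := by
  induction x using ZFSet.inductionOn generalizing y with
  | _ x ih =>
    ext z
    rw [mem_col]
    constructor
    · intro hz
      obtain ⟨w, hw, hs, hc⟩ := (h x y hxy).1 z hz
      exact ⟨w, hw, hs, (ih w hw hc).symm⟩
    · rintro ⟨w, hw, hs, rfl⟩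
      obtain ⟨z, hz, hc⟩ := (h x y hxy).2 w hw hs
      rwa [← ih w hw hc]

theorem isFuncInto_graph {f : ZFSet.{u} → ZFSet.{u}} {d : ZFSet.{u}} {M : Set ZFSet.{u}}
    (h : ∀ a ∈ d, f a ∈ M) : IsFuncInto d M (graph f d) := by
  refine ⟨fun p hp => ?_, fun a ha => ⟨f a, pair_mem_graph.2 ⟨ha, rfl⟩, fun b hb => ?_⟩⟩
  · obtain ⟨a, ha, rfl⟩ := mem_img.1 hp
    exact ⟨a, f a, ha, h a ha, rfl⟩
  · exact (pair_mem_graph.1 hb).2.symm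

theorem transClass_V : TransClass V.{u} := fun _ _ _ _ => Set.mem_univ _

section embedding
open Filter

theorem Ev.mono {U : ZFSet.{u}} {p q : ZFSet.{u} → Prop} (h : Ev U p) (hpq : ∀ i, p i → q i) :
    Ev U q :=
  let ⟨X, hX, h⟩ := h
  ⟨X, hX, fun i hi => hpq i (h i hi)⟩

variable {κ τ U e A ℓ : ZFSet.{u}}

theorem Good.ev_and {M : Set ZFSet.{u}} (h : Good M κ τ U) {p q : ZFSet.{u} → Prop}
    (hp : Ev U p) (hq : Ev U q) :
    Ev U fun i => p i ∧ q i := by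
  obtain ⟨X, hX, hp⟩ := hp
  obtain ⟨Y, hY, hq⟩ := hq
  exact (h.2.1 X hX Y hY).mono fun i hi => ⟨hp i hi.1, hq i hi.2⟩

theorem Good.exists_ultrafilter (h : Good V κ τ U) :
    ∃ W : Ultrafilter ZFSet.{u}, ∀ p : ZFSet.{u} → Prop, (∀ᶠ i in W, p i) ↔ Ev U p := by
  have hne : ∃ X, X ∈ U := by
    rcases h.2.2.1 ∅ (Set.mem_univ _) with ⟨X, hX, -⟩ | ⟨X, hX, -⟩ <;> exact ⟨X, hX⟩
  obtain ⟨X₀, hX₀⟩ := hne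
  let F : Filter ZFSet.{u} :=
    { sets := {S | Ev U fun i => i ∈ S}
      univ_sets := ⟨X₀, hX₀, fun _ _ => Set.mem_univ _⟩
      sets_of_superset := fun h hs => h.mono fun _ hi => hs hi
      inter_sets := fun hs ht => h.ev_and hs ht }
  refine ⟨Ultrafilter.ofComplNotMemIff F fun s => ⟨fun hs => ?_, fun hs hs' => ?_⟩,
    fun p => Iff.rfl⟩
  · rcases h.2.2.1 (ZFSet.sep (fun i => i ∈ s) X₀) (Set.mem_univ _) with h1 | h1
    · exact h1.mono fun i hi => (ZFSet.mem_sep.1 hi).2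
    · refine absurd ?_ hs
      refine (h.ev_and h1 ⟨X₀, hX₀, fun _ hi => hi⟩).mono fun i hi his => hi.1 ?_
      exact ZFSet.mem_sep.2 ⟨hi.2, his⟩
  · obtain ⟨X, hX, hi⟩ := h.ev_and hs hs'
    obtain ⟨i, hiX, -⟩ := (h.1 X hX).1
    exact (hi i hiX).2 (hi i hiX).1

/-- The ultrapower by a normal fine measure is a supercompactness embedding, and it sends `ℓ` to
a function guessing `A` as soon as the measure does so almost everywhere. -/
theorem exists_scEmb (hκ : κ.IsOrdinal) (hτ : τ.IsOrdinal) {β : ZFSet.{u}} (hβ : β ∈ κ)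
    [Infinite β.toSet] (h : Good V κ τ U) (he : Code τ e A) (hg : Guess V U e A ℓ) :
    ∃ E : SCEmb κ τ, ZFSet.pair κ A ∈ E.e.j ℓ := by
  classical
  obtain ⟨W, hW⟩ := h.exists_ultrafilter
  obtain ⟨hidx, -, -, hbelow, hinran, hnb, hnr⟩ := h
  simp only [← hW] at hbelow hinran hnb hnr
  obtain ⟨X₀, hX₀⟩ : ∃ X, X ∈ U := let ⟨X, hX, _⟩ := hg; ⟨X, hX⟩
  have hS : ∀ᶠ i in W, i ∈ X₀ := (hW _).2 ⟨X₀, hX₀, fun _ hi => hi⟩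
  have hI : ∀ᶠ i in W, Idx κ τ i := hS.mono (hidx X₀ hX₀).2
  have hfγ : ∀ i, ∃ f γ, Idx κ τ i → i = ZFSet.pair f γ := fun i => by
    by_cases hi : Idx κ τ i
    · obtain ⟨f, γ, hi, -⟩ := hi
      exact ⟨f, γ, fun _ => hi⟩
    · exact ⟨∅, ∅, fun h => absurd h hi⟩
  choose f γ hfγ using hfγ
  have hδ : ∀ i, ∃ δ, Idx κ τ i → γ i ∈ κ ∧ δ ∈ κ ∧
      (∀ a b, ZFSet.pair a b ∈ f i → a ∈ δ ∧ b ∈ τ) ∧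
      (∀ a ∈ δ, ∃ b, ZFSet.pair a b ∈ f i) ∧
      ∀ a a' b b', ZFSet.pair a b ∈ f i → ZFSet.pair a' b' ∈ f i →
        (a ∈ a' ↔ b ∈ b') ∧ (a = a' ↔ b = b') := fun i => by
    by_cases hi : Idx κ τ i
    · have e := hfγ i hi
      obtain ⟨f', γ', hi, hγ, δ, hδ, h1, h2, h3⟩ := hi
      obtain ⟨rfl, rfl⟩ := ZFSet.pair_inj.1 (e.symm.trans hi)
      have h1 : ∀ a b, ZFSet.pair a b ∈ f i → a ∈ δ ∧ b ∈ τ := fun a b hab => by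
        obtain ⟨a', ha, b', hb, e⟩ := h1 _ hab
        obtain ⟨rfl, rfl⟩ := ZFSet.pair_inj.1 e
        exact ⟨ha, hb⟩
      exact ⟨δ, fun _ => ⟨hγ, hδ, h1, fun a ha => let ⟨b, _, hb⟩ := h2 a ha; ⟨b, hb⟩,
        fun a a' b b' h h' => h3 a (h1 _ _ h).1 a' (h1 _ _ h').1 b (h1 _ _ h).2 b'
          (h1 _ _ h').2 h h'⟩⟩
    · exact ⟨∅, fun h => absurd h hi⟩
  choose δ hδ using hδ
  have hB : ∀ i, Idx κ τ i → ∀ b, Below i b ↔ b ∈ γ i := fun i hi b => by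
    constructor
    · rintro ⟨f', γ', e, hb⟩
      rwa [(ZFSet.pair_inj.1 ((hfγ i hi).symm.trans e)).2]
    · exact fun hb => ⟨_, _, hfγ i hi, hb⟩
  have hR : ∀ i, Idx κ τ i → ∀ b, InRan i b ↔ ∃ a, ZFSet.pair a b ∈ f i := fun i hi b => by
    constructor
    · rintro ⟨f', γ', e, hb⟩
      rwa [(ZFSet.pair_inj.1 ((hfγ i hi).symm.trans e)).1]
    · exact fun hb => ⟨_, _, hfγ i hi, hb⟩
  replace hbelow : ∀ b ∈ κ, ∀ᶠ i in W, b ∈ γ i := fun b hb =>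
    (hI.and (hbelow b hb)).mono fun i hi => (hB i hi.1 b).1 hi.2
  replace hinran : ∀ b ∈ τ, ∀ᶠ i in W, ∃ a, ZFSet.pair a b ∈ f i := fun b hb =>
    (hI.and (hinran b hb)).mono fun i hi => (hR i hi.1 b).1 hi.2
  replace hnb : ∀ G : ZFSet.{u} → ZFSet.{u}, (∀ᶠ i in W, G i ∈ γ i) →
      ∃ b ∈ κ, ∀ᶠ i in W, G i = b := fun G hG => by
    obtain ⟨b, hb, hG⟩ := hnb (graph G X₀) (Set.mem_univ _) <| by
      filter_upwards [hS, hI, hG] with i h1 h2 h3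
      exact ⟨G i, pair_mem_graph.2 ⟨h1, rfl⟩, (hB i h2 _).2 h3⟩
    exact ⟨b, hb, hG.mono fun i hi => (pair_mem_graph.1 hi).2⟩
  replace hnr : ∀ G : ZFSet.{u} → ZFSet.{u}, (∀ᶠ i in W, ∃ a, ZFSet.pair a (G i) ∈ f i) →
      ∃ b ∈ τ, ∀ᶠ i in W, G i = b := fun G hG => by
    obtain ⟨b, hb, hG⟩ := hnr (graph G X₀) (Set.mem_univ _) <| by
      filter_upwards [hS, hI, hG] with i h1 h2 h3
      exact ⟨G i, pair_mem_graph.2 ⟨h1, rfl⟩, (hR i h2 _).2 h3⟩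
    exact ⟨b, hb, hG.mono fun i hi => (pair_mem_graph.1 hi).2⟩
  have hγκ : ∀ᶠ i in W, γ i ∈ κ := hI.mono fun i hi => (hδ i hi).1
  have hω : ∀ F : ZFSet.{u} → ℕ, ∃ n, ∀ᶠ i in W, F i = n := fun F => by
    let c := Infinite.natEmbedding β.toSet
    obtain ⟨b, hb, hc⟩ := hnb (fun i => (c (F i) : ZFSet)) <| by
      filter_upwards [hγκ, hbelow β hβ] with i h1 h2
      exact (hκ.mem h1).mem_trans (c (F i)).2 h2
    obtain ⟨i, hi⟩ := hc.exists
    refine ⟨F i, hc.mono fun k hk => ?_⟩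
    exact c.injective (Subtype.ext (hk.trans hi.symm))
  obtain ⟨cls, cls_eq, mem_cls, los⟩ := exists_ultrapower hS hω
  let N : Set ZFSet.{u} := Set.range cls
  have hN : TransClass N := by
    rintro _ ⟨F, rfl⟩ y hy
    obtain ⟨G, -, rfl⟩ := (mem_cls _ _).1 hy
    exact ⟨G, rfl⟩
  have cls_pair : ∀ F G, cls (fun i => ZFSet.pair (F i) (G i)) = ZFSet.pair (cls F) (cls G) := by
    intro F G
    obtain ⟨φ, hφ⟩ := (Dfn.eqPair.{u} (0 : Fin 3) 1 2).out
    have := los φ ![fun i => ZFSet.pair (F i) (G i), F, G]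
    simp only [hφ V transClass_V] at this
    exact (hφ N hN _).1 (this.2 (Eventually.of_forall fun _ => rfl))
  have cls_mem : ∀ F G, (∀ᶠ i in W, F i ∈ G i) → cls F ∈ cls G := fun F G hF =>
    (mem_cls _ _).2 ⟨F, hF, rfl⟩
  let j : ZFSet.{u} → ZFSet.{u} := fun x => cls fun _ => x
  have const : ∀ {F : ZFSet.{u} → ZFSet.{u}} {b}, (∀ᶠ i in W, F i = b) → cls F = j b :=
    fun hF => (cls_eq _ _).2 hF
  let E : ClassEmb V N :=
    { j := j
      maps := fun x _ => ⟨_, rfl⟩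
      elem := fun φ v hv => ((los φ fun k _ => v k).trans eventually_const).symm }
  have fix : ∀ α ∈ κ, j α = α := by
    intro α
    induction α using ZFSet.inductionOn with
    | _ α ih =>
      intro hα
      ext y
      constructor
      · intro hy
        obtain ⟨F, hF, rfl⟩ := (mem_cls _ _).1 hy
        obtain ⟨b, hb, hF'⟩ := hnb F <| by
          filter_upwards [hF, hγκ, hbelow α hα] with i h1 h2 h3
          exact (hκ.mem h2).mem_trans h1 h3
        obtain ⟨i, hi, hi'⟩ := (hF.and hF').exists
        have : b ∈ α := hi' ▸ hi
        rwa [const hF', ih b this hb]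
      · intro hy
        rw [← ih y hy (hκ.mem_trans hy hα)]
        exact cls_mem _ _ (Eventually.of_forall fun _ => hy)
  have cls_γ : cls γ = κ := by
    ext y
    constructor
    · intro hy
      obtain ⟨F, hF, rfl⟩ := (mem_cls _ _).1 hy
      obtain ⟨b, hb, hF'⟩ := hnb F hF
      rwa [const hF', fix b hb]
    · intro hy
      rw [← fix y hy]
      exact cls_mem _ _ (hbelow y hy)
  have hinv : ∀ b i, ∃ a, (∃ a, ZFSet.pair a b ∈ f i) → ZFSet.pair a b ∈ f i := fun b i => by
    by_cases hb : ∃ a, ZFSet.pair a b ∈ f i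
    · exact ⟨hb.choose, fun _ => hb.choose_spec⟩
    · exact ⟨∅, fun h => absurd h hb⟩
  choose g hg' using hinv
  have hg₁ : ∀ b ∈ τ, ∀ᶠ i in W, ZFSet.pair (g b i) b ∈ f i := fun b hb =>
    (hinran b hb).mono fun i hi => hg' b i hi
  have dom : ∀ F : ZFSet.{u} → ZFSet.{u}, (∀ᶠ i in W, F i ∈ δ i) →
      ∃ b ∈ τ, ∀ᶠ i in W, F i = g b i := fun F hF => by
    have : ∀ i, ∃ b, (∃ b, ZFSet.pair (F i) b ∈ f i) → ZFSet.pair (F i) b ∈ f i := fun i => by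
      by_cases hb : ∃ b, ZFSet.pair (F i) b ∈ f i
      · exact ⟨hb.choose, fun _ => hb.choose_spec⟩
      · exact ⟨∅, fun h => absurd h hb⟩
    choose H hH using this
    have hH' : ∀ᶠ i in W, ZFSet.pair (F i) (H i) ∈ f i := by
      filter_upwards [hF, hI] with i h1 h2
      exact hH i ((hδ i h2).2.2.2.1 _ h1)
    obtain ⟨b, hb, hHb⟩ := hnr H (hH'.mono fun i hi => ⟨_, hi⟩)
    refine ⟨b, hb, ?_⟩
    filter_upwards [hI, hH', hHb, hg₁ b hb] with i h1 h2 h3 h4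
    exact ((hδ i h1).2.2.2.2 _ _ _ _ h2 h4).2.2 h3
  have g_mem : ∀ b ∈ τ, ∀ᶠ i in W, g b i ∈ δ i := fun b hb => by
    filter_upwards [hI, hg₁ b hb] with i h1 h2
    exact ((hδ i h1).2.2.1 _ _ h2).1
  have cls_g : ∀ b ∈ τ, cls (g b) = b := by
    intro b
    induction b using ZFSet.inductionOn with
    | _ b ih =>
      intro hb
      ext y
      constructor
      · intro hy
        obtain ⟨F, hF, rfl⟩ := (mem_cls _ _).1 hy
        obtain ⟨b', hb', hF'⟩ := dom F <| by
          filter_upwards [hI, hF, g_mem b hb] with i h1 h2 h3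
          exact (hκ.mem (hδ i h1).2.1).mem_trans h2 h3
        obtain ⟨i, h1, h2, h3, h4, h5⟩ :=
          (hI.and (hF.and (hF'.and ((hg₁ b hb).and (hg₁ b' hb'))))).exists
        have : b' ∈ b := ((hδ i h1).2.2.2.2 _ _ _ _ h5 h4).1.1 (h3 ▸ h2)
        rwa [(cls_eq _ _).2 hF', ih b' this hb']
      · intro hy
        have hyτ := hτ.mem_trans hy hb
        rw [← ih y hy hyτ]
        refine cls_mem _ _ ?_
        filter_upwards [hI, hg₁ b hb, hg₁ y hyτ] with i h1 h2 h3
        exact ((hδ i h1).2.2.2.2 _ _ _ _ h3 h2).1.2 hy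
  have cls_δ : cls δ = τ := by
    ext y
    constructor
    · intro hy
      obtain ⟨F, hF, rfl⟩ := (mem_cls _ _).1 hy
      obtain ⟨b, hb, hF'⟩ := dom F hF
      rwa [(cls_eq _ _).2 hF', cls_g b hb]
    · intro hy
      rw [← cls_g y hy]
      exact cls_mem _ _ (g_mem y hy)
  have closed : SeqClosed τ N := by
    rintro q ⟨hq, hq'⟩
    have : ∀ b, ∃ G, b ∈ τ → ZFSet.pair b (cls G) ∈ q := fun b => by
      by_cases hb : b ∈ τ
      · obtain ⟨x, hx, -⟩ := hq' b hb
        obtain ⟨_, _, _, ⟨G, rfl⟩, e⟩ := hq _ hx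
        obtain ⟨rfl, rfl⟩ := ZFSet.pair_inj.1 e
        exact ⟨G, fun _ => hx⟩
      · exact ⟨id, fun h => absurd h hb⟩
    choose G hG using this
    let H : ZFSet.{u} → ZFSet.{u} := fun i =>
      img (fun b => ZFSet.pair (g b i) (G b i)) (ZFSet.sep (fun b => ∃ a, ZFSet.pair a b ∈ f i) τ)
    refine ⟨H, ?_⟩
    ext y
    constructor
    · intro hy
      obtain ⟨F, hF, rfl⟩ := (mem_cls _ _).1 hy
      have : ∀ i, ∃ b, F i ∈ H i → (b ∈ τ ∧ ∃ a, ZFSet.pair a b ∈ f i) ∧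
          ZFSet.pair (g b i) (G b i) = F i := fun i => by
        by_cases hi : F i ∈ H i
        · obtain ⟨b, hb, e⟩ := mem_img.1 hi
          exact ⟨b, fun _ => ⟨ZFSet.mem_sep.1 hb, e⟩⟩
        · exact ⟨∅, fun h => absurd h hi⟩
      choose B hB using this
      obtain ⟨b, hb, hBb⟩ := hnr B (hF.mono fun i hi => (hB i hi).1.2)
      have : cls F = cls fun i => ZFSet.pair (g b i) (G b i) := by
        refine (cls_eq _ _).2 ?_
        filter_upwards [hF, hBb] with i h1 h2
        rw [← (hB i h1).2, h2]
      rw [this, cls_pair, cls_g b hb]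
      exact hG b hb
    · intro hy
      obtain ⟨b, x, hb, -, rfl⟩ := hq y hy
      rw [(hq' b hb).unique hy (hG b hb), ← cls_g b hb, ← cls_pair]
      refine cls_mem _ _ ?_
      filter_upwards [hg₁ b hb] with i hi
      exact mem_img.2 ⟨b, ZFSet.mem_sep.2 ⟨hb, _, hi⟩, by rw [cls_g b hb]⟩
  obtain ⟨-, -, he₂, he₃, a₀, ha₀, hA⟩ := he
  have cls_col : ∀ x b, ZFSet.pair b x ∈ e → cls (fun i => col (Sig i e) x) = x := by
    intro x
    induction x using ZFSet.inductionOn with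
    | _ x ih =>
      intro b₀ hx
      ext y
      constructor
      · intro hy
        obtain ⟨F, hF, rfl⟩ := (mem_cls _ _).1 hy
        have : ∀ i, ∃ w b, F i ∈ col (Sig i e) x → w ∈ x ∧ ZFSet.pair b w ∈ e ∧ InRan i b ∧
            col (Sig i e) w = F i := fun i => by
          by_cases hi : F i ∈ col (Sig i e) x
          · obtain ⟨w, hw, ⟨b, hb, hb'⟩, h⟩ := mem_col.1 hi
            exact ⟨w, b, fun _ => ⟨hw, hb, hb', h⟩⟩
          · exact ⟨∅, ∅, fun h => absurd h hi⟩
        choose w B hwB using this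
        obtain ⟨b, -, hb⟩ := hnr B <| by
          filter_upwards [hI, hF] with i h1 h2
          exact (hR i h1 _).1 (hwB i h2).2.2.1
        obtain ⟨k, h1, h2⟩ := (hF.and hb).exists
        have hk := hwB k h1
        have : cls F = cls fun i => col (Sig i e) (w k) := by
          refine (cls_eq _ _).2 ?_
          filter_upwards [hF, hb] with i h3 h4
          rw [← (hwB i h3).2.2.2,
            he₂ _ _ (hwB i h3).2.1 _ _ hk.2.1 (h4.trans h2.symm)]
        rw [this, ih _ hk.1 _ hk.2.1]
        exact hk.1
      · intro hy
        obtain ⟨b, hb, hbτ⟩ := he₃ _ _ hx y hy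
        refine ih y hy b hb ▸ cls_mem (fun i => col (Sig i e) y) _ ?_
        filter_upwards [hI, hinran b hbτ] with i h1 h2
        exact mem_col.2 ⟨y, hy, ⟨b, hb, (hR i h1 _).2 h2⟩, rfl⟩
  have κ_mem : κ ∈ j κ := by
    have := cls_mem γ (fun _ => κ) hγκ
    rwa [cls_γ] at this
  have τ_mem : τ ∈ j κ := by
    have := cls_mem δ (fun _ => κ) (hI.mono fun i hi => (hδ i hi).2.1)
    rwa [cls_δ] at this
  have pair_mem : ZFSet.pair κ A ∈ j ℓ := by
    have := cls_mem (fun i => ZFSet.pair (γ i) (col (Sig i e) A)) (fun _ => ℓ) <| by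
      filter_upwards [hI, (hW _).2 hg] with i h1 h2
      obtain ⟨c, -, hc, f', γ', e', y, hy, hℓ⟩ := h2
      obtain ⟨-, rfl⟩ := ZFSet.pair_inj.1 ((hfγ i h1).symm.trans e')
      rwa [hc.eq_col hy] at hℓ
    rwa [cls_pair, cls_γ, cls_col A a₀ hA] at this
  exact ⟨⟨N, hN, E, ⟨hκ, κ_mem, fun α _ => fix α⟩, closed, τ_mem⟩, pair_mem⟩

end embedding

/-- Elementarity, for relations with a uniform first-order definition. -/
theorem ClassEmb.transfer {M : Set ZFSet.{u}} (e : ClassEmb V M) (hM : TransClass M)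
    {α : Type} [Finite α] (v : α → ZFSet.{u})
    (R : Set ZFSet.{u} → (α → ZFSet.{u}) → Prop) [h : Dfn R] :
    R V v ↔ R M fun k => e.j (v k) := by
  obtain ⟨n, ⟨g⟩⟩ := Finite.exists_equiv_fin α
  obtain ⟨φ, hφ⟩ := (Dfn.relabel (R := R) g).out
  have h1 := hφ V transClass_V fun k => ⟨v (g.symm k), Set.mem_univ _⟩
  have h2 := hφ M hM fun k => ⟨e.j (v (g.symm k)), e.maps _ (Set.mem_univ _)⟩
  simp only [Equiv.symm_apply_apply] at h1 h2
  rw [← h1, e.elem φ (fun k => v (g.symm k)) fun _ => Set.mem_univ _, h2]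

/-- `g` is single-valued. -/
def Functional (g : ZFSet.{u}) : Prop :=
  ∀ x y, ZFSet.pair x y ∈ g → ∀ x' y', ZFSet.pair x' y' ∈ g → x = x' → y = y'

instance {α : Type} (g : α) : Dfn.{u} fun _ v => Functional (v g) := by
  unfold Functional; infer_instance

theorem functional_graph (f : ZFSet.{u} → ZFSet.{u}) (d : ZFSet.{u}) :
    Functional (graph f d) := by
  intro x y h x' y' h' e
  rw [← (pair_mem_graph.1 h).2, ← (pair_mem_graph.1 h').2, e]

namespace SCEmb

variable {κ θ : ZFSet.{u}}

theorem mem_iff (E : SCEmb κ θ) {x y : ZFSet.{u}} : E.e.j x ∈ E.e.j y ↔ x ∈ y :=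
  (E.e.transfer E.trans ![x, y] (fun _ v => v 0 ∈ v 1)).symm

theorem inj (E : SCEmb κ θ) {x y : ZFSet.{u}} : E.e.j x = E.e.j y ↔ x = y :=
  (E.e.transfer E.trans ![x, y] (fun _ v => v 0 = v 1)).symm

theorem map_pair (E : SCEmb κ θ) (x y : ZFSet.{u}) :
    E.e.j (ZFSet.pair x y) = ZFSet.pair (E.e.j x) (E.e.j y) :=
  (E.e.transfer E.trans ![ZFSet.pair x y, x, y] (fun _ v => v 0 = ZFSet.pair (v 1) (v 2))).1 rfl

theorem map_mem (E : SCEmb κ θ) (x : ZFSet.{u}) : E.e.j x ∈ E.M := E.e.maps x (Set.mem_univ _)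

theorem map_empty (E : SCEmb κ θ) : E.e.j ∅ = ∅ := by
  rw [ZFSet.eq_empty]
  intro y hy
  exact (E.e.transfer E.trans ![∅] (fun _ v => ∀ y ∈ v 0, ¬ y = y)).1
    (fun y hy => absurd hy (ZFSet.notMem_empty y)) y hy rfl

theorem pair_mem (E : SCEmb κ θ) {x y : ZFSet.{u}} (hx : x ∈ E.M) (hy : y ∈ E.M) :
    ZFSet.pair x y ∈ E.M := by
  obtain ⟨p, hp, rfl⟩ := (E.e.transfer E.trans ![]
      (fun M (v : Fin 0 → ZFSet.{u}) => ∀ x ∈ M, ∀ y ∈ M, ∃ p ∈ M, p = ZFSet.pair x y)).1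
    (fun x _ y _ => ⟨_, Set.mem_univ _, rfl⟩) x hx y hy
  exact hp

theorem mem_of_card_le (E : SCEmb κ θ) {x : ZFSet.{u}} (hx : ∀ y ∈ x, y ∈ E.M)
    (h : Cardinal.mk x.toSet ≤ Cardinal.mk θ.toSet) : x ∈ E.M := by
  rcases ZFSet.eq_empty_or_nonempty x with rfl | ⟨y₀, hy₀⟩
  · rw [← E.map_empty]
    exact E.map_mem _
  have : Nonempty x.toSet := ⟨⟨y₀, hy₀⟩⟩
  obtain ⟨⟨s, hs⟩⟩ := h
  have hsurj := Function.invFun_surjective hs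
  classical
  let f : ZFSet.{u} → ZFSet.{u} := fun a =>
    if h : a ∈ θ then (Function.invFun s ⟨a, h⟩ : x.toSet) else y₀
  have hfx : ∀ a, f a ∈ x := fun a => by
    by_cases h : a ∈ θ
    · simp only [f, dif_pos h]
      exact (Function.invFun s ⟨a, h⟩).2
    · simpa only [f, dif_neg h]
  have hf : graph f θ ∈ E.M :=
    E.closed _ (isFuncInto_graph fun a _ => hx _ (hfx a))
  have hU : ∀ f a y : ZFSet.{u}, ZFSet.pair a y ∈ f → y ∈ ZFSet.sUnion (ZFSet.sUnion f) := by
    intro f a y h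
    refine ZFSet.mem_sUnion.2 ⟨{a, y}, ZFSet.mem_sUnion.2 ⟨_, h, ?_⟩, ?_⟩ <;> simp [ZFSet.pair]
  obtain ⟨r, hr, h1, h2⟩ := (E.e.transfer E.trans ![]
      (fun M (v : Fin 0 → ZFSet.{u}) => ∀ f ∈ M, ∃ r ∈ M,
      (∀ y ∈ r, ∃ a, ZFSet.pair a y ∈ f) ∧ ∀ a y, ZFSet.pair a y ∈ f → y ∈ r)).1
    (fun f _ => ⟨ZFSet.sep (fun y => ∃ a, ZFSet.pair a y ∈ f)
        (ZFSet.sUnion (ZFSet.sUnion f)), Set.mem_univ _,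
      fun y hy => (ZFSet.mem_sep.1 hy).2, fun a y h => ZFSet.mem_sep.2 ⟨hU f a y h, a, h⟩⟩) _ hf
  convert hr
  ext y
  constructor
  · intro hy
    obtain ⟨⟨a, ha⟩, e⟩ := hsurj ⟨y, hy⟩
    refine h2 a y (pair_mem_graph.2 ⟨ha, ?_⟩)
    have ha : a ∈ θ := ha
    simp only [f, dif_pos ha, e]
  · intro hy
    obtain ⟨a, ha⟩ := h1 y hy
    rw [← (pair_mem_graph.1 ha).2]
    exact hfx a

theorem isOrdinal (E : SCEmb κ θ) : κ.IsOrdinal := E.crit.1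

theorem map_of_mem (E : SCEmb κ θ) {α : ZFSet.{u}} (h : α ∈ κ) : E.e.j α = α :=
  E.crit.2.2 α (E.isOrdinal.mem h) h

theorem insert_mem (E : SCEmb κ θ) {y : ZFSet.{u}} (hy : y ∈ κ) : insert y y ∈ κ := by
  have hyo := E.isOrdinal.mem hy
  have hirr : ∀ z, κ = z ∨ κ ∈ z → z ∈ κ → False := fun z h hz => by
    rcases h with rfl | h
    · exact ZFSet.mem_irrefl _ hz
    · exact ZFSet.mem_asymm h hz
  rcases (ZFSet.isOrdinal_succ hyo).mem_trichotomous E.isOrdinal with h | h | h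
  · exact h
  · have := (E.e.transfer E.trans ![κ, y] (fun _ v => ∀ z ∈ v 0, z = v 1 ∨ z ∈ v 1)).1
      (fun z hz => by
        have hz : z ∈ κ := hz
        rwa [← h, ZFSet.mem_insert_iff] at hz) κ E.crit.2.1
    have this : κ = E.e.j y ∨ κ ∈ E.e.j y := this
    rw [E.map_of_mem hy] at this
    exact (hirr y this hy).elim
  · rw [ZFSet.mem_insert_iff] at h
    exact (hirr y h hy).elim

theorem exists_infinite (E : SCEmb κ θ) : ∃ β ∈ κ, Infinite β.toSet := by
  have hκ : κ.rank.toZFSet = κ := E.isOrdinal.toZFSet_rank_eq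
  have h0 : κ ≠ ∅ := fun h => by
    have h1 : E.e.j κ = ∅ := (congrArg E.e.j h).trans E.map_empty
    exact ZFSet.notMem_empty κ (h1 ▸ E.crit.2.1)
  have hlim : ∀ o < κ.rank, o + 1 < κ.rank := fun o ho => by
    have := E.insert_mem (y := o.toZFSet) (by rwa [← hκ, Ordinal.toZFSet_mem_toZFSet_iff])
    rwa [← Ordinal.toZFSet_add_one, ← hκ, Ordinal.toZFSet_mem_toZFSet_iff] at this
  have hle : Ordinal.omega0 ≤ κ.rank := by
    rw [Ordinal.omega0_le]
    intro n
    suffices (n : Ordinal) < κ.rank from this.le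
    induction n with
    | zero =>
      rw [Nat.cast_zero, pos_iff_ne_zero]
      intro h
      rw [h, Ordinal.toZFSet_zero] at hκ
      exact h0 hκ.symm
    | succ n ih => exact_mod_cast hlim _ ih
  have hinf : Infinite (Ordinal.omega0.{u}).toZFSet.toSet := by
    refine Infinite.of_injective (fun n : ℕ => ⟨(n : Ordinal).toZFSet, ?_⟩) ?_
    · exact Ordinal.toZFSet_mem_toZFSet_iff.2 (Ordinal.natCast_lt_omega0 n)
    · intro a b h
      exact_mod_cast Ordinal.toZFSet_injective (congrArg Subtype.val h)
  refine ⟨Ordinal.omega0.toZFSet, ?_, hinf⟩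
  rw [← hκ, Ordinal.toZFSet_mem_toZFSet_iff]
  refine hle.lt_of_ne fun hω => ?_
  have := (E.e.transfer E.trans ![κ]
      (fun _ v => ∀ x ∈ v 0, (∀ y ∈ x, ¬ y = y) ∨
    ∃ y ∈ v 0, y ∈ x ∧ ∀ z ∈ x, z = y ∨ z ∈ y)).1 (fun x hx => ?_) κ E.crit.2.1
  · rcases this with h | ⟨y, -, h1, h2⟩
    · exact h0 ((ZFSet.eq_empty κ).2 fun y hy => h y hy rfl)
    · rcases h2 _ (E.insert_mem h1) with h | h
      · have hy : y ∈ insert y y := ZFSet.mem_insert y y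
        rw [h] at hy
        exact ZFSet.mem_irrefl y hy
      · exact ZFSet.mem_asymm h (by simp)
  · have hx : x ∈ κ := hx
    rw [← hκ, ← hω, Ordinal.mem_toZFSet_iff] at hx
    obtain ⟨o, ho, rfl⟩ := hx
    obtain ⟨n, rfl⟩ := Ordinal.lt_omega0.1 ho
    rcases n with _ | n
    · left
      simp
    · right
      refine ⟨(n : Ordinal).toZFSet, ?_, ?_⟩
      · show _ ∈ κ
        rw [← hκ, ← hω, Ordinal.toZFSet_mem_toZFSet_iff]
        exact Ordinal.natCast_lt_omega0 n
      · rw [Nat.cast_succ, Ordinal.toZFSet_add_one]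
        simp

theorem exists_notMem_image (E : SCEmb κ θ) {τ : ZFSet.{u}} (hτ : τ ∈ κ)
    (f : ZFSet.{u} → ZFSet.{u}) :
    ∃ b ∈ κ, ∀ a ∈ τ, f a ≠ b := by
  by_contra! h
  have h1 := (E.e.transfer E.trans ![κ, τ, graph f τ]
    (fun _ v => ∀ b ∈ v 0, ∃ a ∈ v 1, ZFSet.pair a b ∈ v 2)).1 (fun b hb => by
      obtain ⟨a, ha, e⟩ := h b hb
      exact ⟨a, ha, pair_mem_graph.2 ⟨ha, e⟩⟩) κ E.crit.2.1
  obtain ⟨a, ha, h1⟩ : ∃ a ∈ E.e.j τ, ZFSet.pair a κ ∈ E.e.j (graph f τ) := h1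
  rw [E.map_of_mem hτ] at ha
  have h2 : Functional (E.e.j (graph f τ)) :=
    (E.e.transfer E.trans ![graph f τ] (fun _ v => Functional (v 0))).1 (functional_graph f τ)
  have h3 : ZFSet.pair (E.e.j a) (E.e.j (f a)) ∈ E.e.j (graph f τ) := by
    rw [← E.map_pair, E.mem_iff]
    exact pair_mem_graph.2 ⟨ha, rfl⟩
  have h4 := h2 _ _ h1 _ _ h3 (E.map_of_mem (E.isOrdinal.mem_trans ha hτ)).symm
  have h5 : f a ∈ κ := by
    rw [← E.mem_iff, ← h4]
    exact E.crit.2.1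
  rw [E.map_of_mem h5] at h4
  rw [← h4] at h5
  exact ZFSet.mem_irrefl _ h5

theorem memV_of_code (E : SCEmb κ θ) {τ e A : ZFSet.{u}} (hτ : τ ∈ κ) (h : Code τ e A) :
    MemV κ A := by
  obtain ⟨h1, -, h3, h4, a₀, -, hA⟩ := h
  by_contra hn
  have key : ∀ x a, ZFSet.pair a x ∈ e → ∀ o ≤ x.rank, ∃ a ∈ τ, ∃ y, ZFSet.pair a y ∈ e ∧
      y.rank = o := by
    intro x
    induction x using ZFSet.inductionOn with
    | _ x ih =>
      intro a ha o ho
      rcases ho.eq_or_lt with rfl | ho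
      · obtain ⟨a', x', e', h⟩ := h1 _ ha
        obtain ⟨rfl, rfl⟩ := ZFSet.pair_inj.1 e'
        exact ⟨a, h, x, ha, rfl⟩
      · obtain ⟨y, hy, ho⟩ := ZFSet.lt_rank_iff.1 ho
        obtain ⟨b, hb, -⟩ := h4 _ _ ha y hy
        exact ih y hy b hb o ho
  classical
  obtain ⟨b, hb, hf⟩ := E.exists_notMem_image hτ fun a =>
    if h : ∃ y, ZFSet.pair a y ∈ e then h.choose.rank.toZFSet else ∅
  obtain ⟨a, ha, y, hy, hr⟩ := key A a₀ hA b.rank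
    ((ZFSet.rank_lt_of_mem hb).le.trans (not_lt.1 hn))
  refine hf a ha ?_
  have hex : ∃ y, ZFSet.pair a y ∈ e := ⟨y, hy⟩
  rw [dif_pos hex, h3 _ _ hex.choose_spec _ _ hy rfl, hr,
    (E.isOrdinal.mem hb).toZFSet_rank_eq]

theorem rank_map_le (E : SCEmb κ θ) {x : ZFSet.{u}} (hx : MemV κ x) : (E.e.j x).rank ≤ x.rank := by
  let f : ZFSet.{u} → ZFSet.{u} := fun y => y.rank.toZFSet
  let R := graph f (ZFSet.vonNeumann (x.rank + 1))
  have h1 := (E.e.transfer E.trans ![R]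
      (fun _ v => ∀ y b, ZFSet.pair y b ∈ v 0 →
    ∀ z ∈ y, ∃ b' ∈ b, ZFSet.pair z b' ∈ v 0)).1 (fun y b h z hz => by
      obtain ⟨hy, rfl⟩ := pair_mem_graph.1 h
      have hzy := ZFSet.rank_lt_of_mem hz
      refine ⟨f z, Ordinal.toZFSet_mem_toZFSet_iff.2 hzy, pair_mem_graph.2 ⟨?_, rfl⟩⟩
      rw [ZFSet.mem_vonNeumann] at hy ⊢
      exact hzy.trans hy)
  have h2 : ∀ y b, ZFSet.pair y b ∈ E.e.j R → y.rank ≤ b.rank := by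
    intro y
    induction y using ZFSet.inductionOn with
    | _ y ih =>
      intro b hb
      rw [ZFSet.rank_le_iff]
      intro z hz
      obtain ⟨b', hb', h⟩ := h1 y b hb z hz
      exact (ih z hz b' h).trans_lt (ZFSet.rank_lt_of_mem hb')
  have hκ : κ.rank.toZFSet = κ := E.isOrdinal.toZFSet_rank_eq
  have hfx : f x ∈ κ := by
    rw [← hκ]
    exact Ordinal.toZFSet_mem_toZFSet_iff.2 hx
  have h3 : ZFSet.pair x (f x) ∈ R :=
    pair_mem_graph.2 ⟨ZFSet.mem_vonNeumann.2 (Order.lt_succ _), rfl⟩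
  rw [← E.mem_iff, E.map_pair, E.map_of_mem hfx] at h3
  simpa [f] using h2 _ _ h3

theorem map_of_memV (E : SCEmb κ θ) {x : ZFSet.{u}} (hx : MemV κ x) : E.e.j x = x := by
  suffices ∀ o, ∀ x : ZFSet.{u}, x.rank = o → MemV κ x → E.e.j x = x from this _ x rfl hx
  intro o
  induction o using WellFoundedLT.induction with
  | _ o ih =>
    rintro x rfl hx
    have hfix : ∀ y : ZFSet.{u}, y.rank < x.rank → E.e.j y = y := fun y hy =>
      ih _ hy y rfl (hy.trans hx)
    ext z
    constructor
    · intro hz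
      rwa [← E.mem_iff, hfix z ((ZFSet.rank_lt_of_mem hz).trans_le (E.rank_map_le hx))]
    · intro hz
      have hz' := E.mem_iff.2 hz
      rwa [hfix z (ZFSet.rank_lt_of_mem hz)] at hz'

theorem pair_mem_map_iff (E : SCEmb κ θ) {f : ZFSet.{u} → ZFSet.{u}}
    (hf : ∀ γ ∈ κ, MemV κ (f γ)) {γ y : ZFSet.{u}} (hγ : γ ∈ κ) :
    ZFSet.pair γ y ∈ E.e.j (graph f κ) ↔ ZFSet.pair γ y ∈ graph f κ := by
  have h0 : ZFSet.pair γ (f γ) ∈ graph f κ := pair_mem_graph.2 ⟨hγ, rfl⟩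
  have h1 := h0
  rw [← E.mem_iff, E.map_pair, E.map_of_mem hγ, E.map_of_memV (hf γ hγ)] at h1
  have h2 : Functional (E.e.j (graph f κ)) :=
    (E.e.transfer E.trans ![graph f κ] (fun _ v => Functional (v 0))).1 (functional_graph f κ)
  constructor
  · intro h
    rwa [h2 _ _ h _ _ h1 rfl]
  · intro h
    rwa [← (pair_mem_graph.1 h).2]

end SCEmb

open Cardinal

theorem card_mono {x y : ZFSet.{u}} (h : ∀ z ∈ x, z ∈ y) : #x.toSet ≤ #y.toSet :=
  mk_le_mk_of_subset h

theorem card_img_le (f : ZFSet.{u} → ZFSet.{u}) (d : ZFSet.{u}) :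
    #(img f d).toSet ≤ #d.toSet := by
  have : (img f d).toSet = f '' d.toSet := Set.ext fun _ => mem_img
  rw [this]
  exact mk_image_le

theorem card_prod_le (x y : ZFSet.{u}) : #(ZFSet.prod x y).toSet ≤ #x.toSet * #y.toSet := by
  have : (ZFSet.prod x y).toSet = (fun p : ZFSet × ZFSet => ZFSet.pair p.1 p.2) ''
      (x.toSet ×ˢ y.toSet) := by
    ext p
    refine ZFSet.mem_prod.trans ⟨?_, ?_⟩
    · rintro ⟨a, ha, b, hb, rfl⟩
      exact ⟨(a, b), ⟨ha, hb⟩, rfl⟩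
    · rintro ⟨⟨a, b⟩, ⟨ha, hb⟩, rfl⟩
      exact ⟨a, ha, b, hb, rfl⟩
  rw [this, ← mk_setProd]
  exact mk_image_le

theorem card_le_two_power {U I : ZFSet.{u}} (h : ∀ X ∈ U, X ⊆ I) : #U.toSet ≤ 2 ^ #I.toSet := by
  rw [← mk_set]
  refine mk_le_of_injective (f := fun X => {i | i.1 ∈ X.1}) ?_
  rintro ⟨X, hX⟩ ⟨Y, hY⟩ e
  refine Subtype.ext (ZFSet.ext fun z => ?_)
  constructor
  · intro hz
    exact (Set.ext_iff.1 e ⟨z, h X hX hz⟩).1 hz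
  · intro hz
    exact (Set.ext_iff.1 e ⟨z, h Y hY hz⟩).2 hz

/-- The set of all indices. -/
noncomputable def idxSet (κ τ : ZFSet.{u}) : ZFSet.{u} :=
  ZFSet.sep (Idx κ τ) (ZFSet.prod (ZFSet.powerset (ZFSet.prod κ τ)) κ)

section idx
variable {κ τ i : ZFSet.{u}}

theorem Idx.eq_pair (hκ : κ.IsOrdinal) (h : Idx κ τ i) :
    ∃ f γ, i = ZFSet.pair f γ ∧ f ⊆ ZFSet.prod κ τ ∧ γ ∈ κ := by
  obtain ⟨f, γ, e, hγ, δ, hδ, h1, -⟩ := h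
  refine ⟨f, γ, e, fun p hp => ?_, hγ⟩
  obtain ⟨a, ha, b, hb, rfl⟩ := h1 p hp
  exact ZFSet.mem_prod.2 ⟨a, hκ.mem_trans ha hδ, b, hb, rfl⟩

theorem mem_idxSet (hκ : κ.IsOrdinal) : i ∈ idxSet κ τ ↔ Idx κ τ i := by
  rw [idxSet, ZFSet.mem_sep]
  refine ⟨And.right, fun h => ⟨?_, h⟩⟩
  obtain ⟨f, γ, rfl, hf, hγ⟩ := h.eq_pair hκ
  exact ZFSet.mem_prod.2 ⟨f, ZFSet.mem_powerset.2 hf, γ, hγ, rfl⟩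

theorem Idx.below (hκ : κ.IsOrdinal) (h : Idx κ τ i) {b : ZFSet.{u}} (hb : Below i b) :
    b ∈ κ := by
  obtain ⟨f, γ, rfl, hf, hγ⟩ := h.eq_pair hκ
  obtain ⟨f', γ', e, hb⟩ := hb
  obtain ⟨rfl, rfl⟩ := ZFSet.pair_inj.1 e
  exact hκ.mem_trans hb hγ

theorem Idx.inRan (hκ : κ.IsOrdinal) (h : Idx κ τ i) {b : ZFSet.{u}} (hb : InRan i b) :
    b ∈ τ := by
  obtain ⟨f, γ, rfl, hf, hγ⟩ := h.eq_pair hκ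
  obtain ⟨f', γ', e, a, hb⟩ := hb
  obtain ⟨rfl, rfl⟩ := ZFSet.pair_inj.1 e
  exact (ZFSet.pair_mem_prod.1 (hf hb)).2

end idx

theorem Good.of_V {M : Set ZFSet.{u}} {κ τ U : ZFSet.{u}} (h : Good V κ τ U) : Good M κ τ U :=
  ⟨h.1, h.2.1, fun X _ => h.2.2.1 X (Set.mem_univ _), h.2.2.2.1, h.2.2.2.2.1,
    fun F _ => h.2.2.2.2.2.1 F (Set.mem_univ _), fun F _ => h.2.2.2.2.2.2 F (Set.mem_univ _)⟩

theorem Good.ev_idx {M : Set ZFSet.{u}} {κ τ U : ZFSet.{u}} (h : Good M κ τ U)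
    {p : ZFSet.{u} → Prop} (hp : Ev U p) : Ev U fun i => Idx κ τ i ∧ p i :=
  let ⟨X, hX, hp⟩ := hp
  ⟨X, hX, fun i hi => ⟨(h.1 X hX).2 i hi, hp i hi⟩⟩

namespace SCEmb
variable {κ θ τ U : ZFSet.{u}}

theorem mem_M_of_idx (E : SCEmb κ θ) (h₀ : ℵ₀ ≤ #θ.toSet) (hκ : #κ.toSet ≤ #θ.toSet)
    (hτ : #τ.toSet ≤ #θ.toSet) (hτM : ∀ b ∈ τ, b ∈ E.M) {i : ZFSet.{u}} (hi : Idx κ τ i) :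
    i ∈ E.M := by
  have hκM : κ ∈ E.M := E.trans _ (E.map_mem κ) _ E.crit.2.1
  obtain ⟨f, γ, rfl, hf, hγ⟩ := hi.eq_pair E.isOrdinal
  refine E.pair_mem (E.mem_of_card_le (fun p hp => ?_) ?_) (E.trans _ hκM _ hγ)
  · obtain ⟨a, ha, b, hb, rfl⟩ := ZFSet.mem_prod.1 (hf hp)
    exact E.pair_mem (E.trans _ hκM _ ha) (hτM b hb)
  · refine (card_mono hf).trans ((card_prod_le _ _).trans ?_)
    exact (mul_le_mul' hκ hτ).trans (mul_eq_self h₀).le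

theorem good_V_of_good (E : SCEmb κ θ) (h₀ : ℵ₀ ≤ #θ.toSet) (hκ : #κ.toSet ≤ #θ.toSet)
    (hτ : #τ.toSet ≤ #θ.toSet) (hI : #(idxSet κ τ).toSet ≤ #θ.toSet) (hτM : ∀ b ∈ τ, b ∈ E.M)
    (h : Good E.M κ τ U) : Good V κ τ U := by
  have hκM : κ ∈ E.M := E.trans _ (E.map_mem κ) _ E.crit.2.1
  have hIM : ∀ i ∈ idxSet κ τ, i ∈ E.M := fun i hi =>
    E.mem_M_of_idx h₀ hκ hτ hτM ((mem_idxSet E.isOrdinal).1 hi)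
  have hprod : ∀ F d : ZFSet.{u}, #d.toSet ≤ #θ.toSet → (∀ b ∈ d, b ∈ E.M) →
      ZFSet.sep (fun p => p ∈ F) (ZFSet.prod (idxSet κ τ) d) ∈ E.M := fun F d hd hdM => by
    refine E.mem_of_card_le (fun p hp => ?_) ?_
    · obtain ⟨i, hi, b, hb, rfl⟩ := ZFSet.mem_prod.1 (ZFSet.mem_sep.1 hp).1
      exact E.pair_mem (hIM i hi) (hdM b hb)
    · refine (card_mono fun _ hp => (ZFSet.mem_sep.1 hp).1).trans ((card_prod_le _ _).trans ?_)
      exact (mul_le_mul' hI hd).trans (mul_eq_self h₀).le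
  refine ⟨h.1, h.2.1, fun X _ => ?_, h.2.2.2.1, h.2.2.2.2.1, fun F _ hF => ?_, fun F _ hF => ?_⟩
  · have hX : ZFSet.sep (fun i => i ∈ X) (idxSet κ τ) ∈ E.M :=
      E.mem_of_card_le (fun i hi => hIM i (ZFSet.mem_sep.1 hi).1)
        ((card_mono fun _ hp => (ZFSet.mem_sep.1 hp).1).trans hI)
    rcases h.2.2.1 _ hX with h1 | h1
    · exact .inl (h1.mono fun i hi => (ZFSet.mem_sep.1 hi).2)
    · refine .inr ((h.ev_idx h1).mono fun i hi hiX => hi.2 ?_)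
      exact ZFSet.mem_sep.2 ⟨(mem_idxSet E.isOrdinal).2 hi.1, hiX⟩
  · obtain ⟨b, hb, h1⟩ := h.2.2.2.2.2.1 _ (hprod F κ hκ fun b hb => E.trans _ hκM _ hb) <| by
      refine (h.ev_idx hF).mono ?_
      rintro i ⟨hi, b, hb, hib⟩
      exact ⟨b, ZFSet.mem_sep.2 ⟨ZFSet.pair_mem_prod.2 ⟨(mem_idxSet E.isOrdinal).2 hi,
        hi.below E.isOrdinal hib⟩, hb⟩, hib⟩
    exact ⟨b, hb, h1.mono fun i hi => (ZFSet.mem_sep.1 hi).2⟩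
  · obtain ⟨b, hb, h1⟩ := h.2.2.2.2.2.2 _ (hprod F τ hτ hτM) <| by
      refine (h.ev_idx hF).mono ?_
      rintro i ⟨hi, b, hb, hib⟩
      exact ⟨b, ZFSet.mem_sep.2 ⟨ZFSet.pair_mem_prod.2 ⟨(mem_idxSet E.isOrdinal).2 hi,
        hi.inRan E.isOrdinal hib⟩, hb⟩, hib⟩
    exact ⟨b, hb, h1.mono fun i hi => (ZFSet.mem_sep.1 hi).2⟩

/-- The order isomorphism `j ↾ τ`, paired with the critical point. -/
noncomputable def seed (E : SCEmb κ θ) (τ : ZFSet.{u}) : ZFSet.{u} :=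
  ZFSet.pair (graph E.e.j τ) κ

/-- The measure on the indices derived from the embedding. -/
noncomputable def measure (E : SCEmb κ θ) (τ : ZFSet.{u}) : ZFSet.{u} :=
  ZFSet.sep (fun X => E.seed τ ∈ E.e.j X) (ZFSet.powerset (idxSet κ τ))

theorem below_seed (E : SCEmb κ θ) {b : ZFSet.{u}} : Below (E.seed τ) b ↔ b ∈ κ := by
  constructor
  · rintro ⟨f, γ, e, hb⟩
    rwa [(ZFSet.pair_inj.1 e).2]
  · exact fun hb => ⟨_, _, rfl, hb⟩

theorem inRan_seed (E : SCEmb κ θ) {b : ZFSet.{u}} :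
    InRan (E.seed τ) b ↔ ∃ a ∈ τ, E.e.j a = b := by
  constructor
  · rintro ⟨f, γ, e, a, hb⟩
    rw [← (ZFSet.pair_inj.1 e).1, pair_mem_graph] at hb
    exact ⟨a, hb⟩
  · exact fun ⟨a, hb⟩ => ⟨_, _, rfl, a, pair_mem_graph.2 hb⟩

theorem seed_mem (E : SCEmb κ θ) (hτ : #τ.toSet ≤ #θ.toSet) (hτM : ∀ b ∈ τ, b ∈ E.M) :
    E.seed τ ∈ E.M := by
  refine E.pair_mem (E.mem_of_card_le (fun p hp => ?_) ((card_img_le _ _).trans hτ))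
    (E.trans _ (E.map_mem κ) _ E.crit.2.1)
  obtain ⟨a, ha, rfl⟩ := mem_img.1 hp
  exact E.pair_mem (hτM a ha) (E.map_mem a)

theorem seed_mem_map_idxSet (E : SCEmb κ θ) (hτ : #τ.toSet ≤ #θ.toSet)
    (hτM : ∀ b ∈ τ, b ∈ E.M) (hτκ : τ ∈ E.e.j κ) : E.seed τ ∈ E.e.j (idxSet κ τ) := by
  have h := (E.e.transfer E.trans ![κ, τ, idxSet κ τ]
    (fun M v => ∀ i ∈ M, Idx (v 0) (v 1) i → i ∈ v 2)).1
    (fun i _ hi => (mem_idxSet E.isOrdinal).2 hi)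
  refine h _ (E.seed_mem hτ hτM) ⟨_, _, rfl, E.crit.2.1, τ, hτκ, ?_, ?_, ?_⟩
  · intro p hp
    obtain ⟨a, ha, rfl⟩ := mem_img.1 hp
    exact ⟨a, ha, _, E.mem_iff.2 ha, rfl⟩
  · intro a ha
    exact ⟨_, E.mem_iff.2 ha, pair_mem_graph.2 ⟨ha, rfl⟩⟩
  · intro a _ a' _ b _ b' _ hab hab'
    obtain ⟨-, rfl⟩ := pair_mem_graph.1 hab
    obtain ⟨-, rfl⟩ := pair_mem_graph.1 hab'
    exact ⟨E.mem_iff.symm, E.inj.symm⟩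

theorem ev_measure (E : SCEmb κ θ) (hs : E.seed τ ∈ E.e.j (idxSet κ τ)) {n : ℕ}
    (v : Fin n → ZFSet.{u}) (P : Set ZFSet.{u} → (Fin n → ZFSet.{u}) → ZFSet.{u} → Prop)
    [Dfn (α := Option (Fin n)) fun M v => P M (fun a => v (some a)) (v none)] :
    Ev (E.measure τ) (P V v) ↔ P E.M (fun k => E.e.j (v k)) (E.seed τ) := by
  let Y := ZFSet.sep (P V v) (idxSet κ τ)
  have hD : Dfn (α := Option (Option (Option (Fin n)))) fun M v =>
      P M (fun a => v (some (some (some a)))) (v none) :=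
    Dfn.relabel (R := fun M v => P M (fun a => v (some a)) (v none))
      (Option.map fun a => some (some a))
  have h1 := (E.e.transfer E.trans
    (fun o : Option (Option (Fin n)) => o.elim Y fun o => o.elim (idxSet κ τ) v)
    (fun M v => ∀ i ∈ v (some none), (i ∈ v none ↔ P M (fun a => v (some (some a))) i))).1
    (fun i hi => by
      show i ∈ Y ↔ _
      rw [ZFSet.mem_sep]
      exact and_iff_right hi)
  have h2 : E.seed τ ∈ E.e.j Y ↔ P E.M (fun k => E.e.j (v k)) (E.seed τ) := h1 _ hs
  rw [← h2]
  constructor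
  · rintro ⟨X, hX, h⟩
    obtain ⟨hXI, hX⟩ := ZFSet.mem_sep.1 hX
    exact (E.e.transfer E.trans ![X, Y] (fun _ v => ∀ i ∈ v 0, i ∈ v 1)).1
      (fun i hi => ZFSet.mem_sep.2 ⟨ZFSet.mem_powerset.1 hXI hi, h i hi⟩) _ hX
  · intro h
    refine ⟨Y, ZFSet.mem_sep.2 ⟨ZFSet.mem_powerset.2 fun i hi => (ZFSet.mem_sep.1 hi).1, h⟩, ?_⟩
    exact fun i hi => (ZFSet.mem_sep.1 hi).2

theorem good_measure (E : SCEmb κ θ) (hs : E.seed τ ∈ E.e.j (idxSet κ τ)) :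
    Good V κ τ (E.measure τ) := by
  refine ⟨fun X hX => ?_, fun X hX Y hY => ?_, fun X _ => ?_, fun b hb => ?_, fun b hb => ?_,
    fun F _ hF => ?_, fun F _ hF => ?_⟩
  · obtain ⟨hXI, hX⟩ := ZFSet.mem_sep.1 hX
    have hXI : ∀ i ∈ X, Idx κ τ i := fun i hi =>
      (mem_idxSet E.isOrdinal).1 (ZFSet.mem_powerset.1 hXI hi)
    refine ⟨?_, hXI⟩
    rcases ZFSet.eq_empty_or_nonempty X with rfl | ⟨i, hi⟩
    · rw [E.map_empty] at hX
      exact (ZFSet.notMem_empty _ hX).elim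
    · exact ⟨i, hi, hXI i hi⟩
  · exact (E.ev_measure hs ![X, Y] fun _ v i => i ∈ v 0 ∧ i ∈ v 1).2
      ⟨(ZFSet.mem_sep.1 hX).2, (ZFSet.mem_sep.1 hY).2⟩
  · have h1 := E.ev_measure hs ![X] fun _ v i => i ∈ v 0
    have h2 := E.ev_measure hs ![X] fun _ v i => ¬ i ∈ v 0
    by_cases h : E.seed τ ∈ E.e.j X
    · exact .inl (h1.2 h)
    · exact .inr (h2.2 h)
  · have hb' : E.e.j b ∈ κ := by rwa [E.map_of_mem hb]
    exact (E.ev_measure hs ![b] fun _ v i => Below i (v 0)).2 (E.below_seed.2 hb')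
  · exact (E.ev_measure hs ![b] fun _ v i => InRan i (v 0)).2 (E.inRan_seed.2 ⟨b, hb, rfl⟩)
  · obtain ⟨b, hb, hb'⟩ := (E.ev_measure hs ![F] fun _ v i =>
      ∃ b, ZFSet.pair i b ∈ v 0 ∧ Below i b).1 hF
    rw [E.below_seed] at hb'
    refine ⟨b, hb', (E.ev_measure hs ![F, b] fun _ v i => ZFSet.pair i (v 1) ∈ v 0).2 ?_⟩
    show ZFSet.pair _ (E.e.j b) ∈ E.e.j F
    rwa [E.map_of_mem hb']
  · obtain ⟨b, hb, hb'⟩ := (E.ev_measure hs ![F] fun _ v i =>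
      ∃ b, ZFSet.pair i b ∈ v 0 ∧ InRan i b).1 hF
    obtain ⟨a, ha, rfl⟩ := E.inRan_seed.1 hb'
    exact ⟨a, ha, (E.ev_measure hs ![F, a] fun _ v i => ZFSet.pair i (v 1) ∈ v 0).2 hb⟩

theorem measure_mem (E : SCEmb κ θ) (h₀ : ℵ₀ ≤ #θ.toSet) (hκ : #κ.toSet ≤ #θ.toSet)
    (hτ : #τ.toSet ≤ #θ.toSet) (hI : 2 ^ #(idxSet κ τ).toSet ≤ #θ.toSet)
    (hτM : ∀ b ∈ τ, b ∈ E.M) : E.measure τ ∈ E.M := by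
  have hX : ∀ X ∈ E.measure τ, X ⊆ idxSet κ τ := fun X hX =>
    ZFSet.mem_powerset.1 (ZFSet.mem_sep.1 hX).1
  refine E.mem_of_card_le (fun X h => E.mem_of_card_le (fun i hi => ?_) ?_)
    ((card_le_two_power hX).trans hI)
  · exact E.mem_M_of_idx h₀ hκ hτ hτM ((mem_idxSet E.isOrdinal).1 (hX X h hi))
  · exact (card_mono (hX X h)).trans ((cantor _).le.trans hI)

theorem guess_measure (E : SCEmb κ θ) (hs : E.seed τ ∈ E.e.j (idxSet κ τ))
    (hτ : #τ.toSet ≤ #θ.toSet) {e A ℓ : ZFSet.{u}} (heM : e ∈ E.M) (he : Code τ e A)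
    (hA : ZFSet.pair κ A ∈ E.e.j ℓ) : Guess E.M (E.measure τ) e A ℓ := by
  obtain ⟨he1, he2, he3, he4, a₀, ha₀, hA₀⟩ := he
  have heτ : ∀ {a x}, ZFSet.pair a x ∈ e → a ∈ τ := fun h => by
    obtain ⟨_, _, e', h⟩ := he1 _ h
    rwa [(ZFSet.pair_inj.1 e').1]
  have : ∀ a, ∃ x, a ∈ τ → ZFSet.pair a x ∈ e := fun a => by
    by_cases h : a ∈ τ
    · obtain ⟨x, hx⟩ := he2 a h
      exact ⟨x, fun _ => hx⟩
    · exact ⟨∅, fun h' => absurd h' h⟩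
  choose g hg using this
  let t := img g τ
  have ht : ∀ x, x ∈ t ↔ ∃ a, ZFSet.pair a x ∈ e := fun x => by
    rw [mem_img]
    constructor
    · rintro ⟨a, ha, rfl⟩
      exact ⟨a, hg a ha⟩
    · rintro ⟨a, ha⟩
      exact ⟨a, heτ ha, he3 _ _ (hg a (heτ ha)) _ _ ha rfl⟩
  have htt : ∀ x ∈ t, ∀ y ∈ x, y ∈ t := fun x hx y hy => by
    obtain ⟨a, ha⟩ := (ht x).1 hx
    obtain ⟨b, hb, -⟩ := he4 _ _ ha y hy
    exact (ht y).2 ⟨b, hb⟩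
  have htM : ∀ x ∈ t, x ∈ E.M := fun x hx => by
    obtain ⟨a, ha⟩ := (ht x).1 hx
    exact (E.trans.of_pair (E.trans _ heM _ ha)).2
  have htc : #t.toSet ≤ #θ.toSet := (card_img_le _ _).trans hτ
  have hAt : A ∈ t := (ht A).2 ⟨a₀, hA₀⟩
  have hV : Guess V (E.measure τ) e A ℓ := by
    refine (E.ev_measure hs ![e, A, ℓ] fun M v i => ∃ c ∈ M, Coll i (v 0) c ∧
      ∃ f γ, i = ZFSet.pair f γ ∧ ∃ y, ZFSet.pair (v 1) y ∈ c ∧ ZFSet.pair γ y ∈ v 2).2 ?_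
    have hc : ∀ x y, ZFSet.pair x y ∈ img (fun x => ZFSet.pair (E.e.j x) x) t ↔
        y ∈ t ∧ E.e.j y = x := fun x y => by
      rw [mem_img]
      constructor
      · rintro ⟨z, hz, e'⟩
        obtain ⟨rfl, rfl⟩ := ZFSet.pair_inj.1 e'
        exact ⟨hz, rfl⟩
      · rintro ⟨hy, rfl⟩
        exact ⟨y, hy, rfl⟩
    refine ⟨img (fun x => ZFSet.pair (E.e.j x) x) t, E.mem_of_card_le (fun p hp => ?_)
      ((card_img_le _ _).trans htc), ?_, _, _, rfl, A, (hc _ _).2 ⟨hAt, rfl⟩, hA⟩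
    · obtain ⟨x, hx, rfl⟩ := mem_img.1 hp
      exact E.pair_mem (E.map_mem x) (htM x hx)
    · intro x y hxy
      obtain ⟨hy, rfl⟩ := (hc x y).1 hxy
      refine ⟨fun z hz => ?_, ?_⟩
      · have hzt := htt y hy z hz
        obtain ⟨a, ha⟩ := (ht z).1 hzt
        refine ⟨E.e.j z, E.mem_iff.2 hz, ⟨E.e.j a, ?_, E.inRan_seed.2 ⟨a, heτ ha, rfl⟩⟩,
          (hc _ _).2 ⟨hzt, rfl⟩⟩
        show _ ∈ E.e.j e
        rw [← E.map_pair, E.mem_iff]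
        exact ha
      · rintro w hw ⟨b, hb, hb'⟩
        obtain ⟨a, ha, rfl⟩ := E.inRan_seed.1 hb'
        have hz : ZFSet.pair (E.e.j a) (E.e.j (g a)) ∈ E.e.j e := by
          rw [← E.map_pair, E.mem_iff]
          exact hg a ha
        have hf : Functional (E.e.j e) :=
          (E.e.transfer E.trans ![e] (fun _ v => Functional (v 0))).1 he3
        obtain rfl := hf _ _ hz _ _ hb rfl
        rw [E.mem_iff] at hw
        exact ⟨g a, hw, (hc _ _).2 ⟨htt y hy _ hw, rfl⟩⟩
  refine hV.mono ?_
  rintro i ⟨c, -, hc, f, γ, rfl, y, hAy, hy⟩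
  have hcol : ∀ x ∈ t, col (Sig (ZFSet.pair f γ) e) x ∈ E.M := by
    intro x
    induction x using ZFSet.inductionOn with
    | _ x ih =>
      intro hx
      refine E.mem_of_card_le (fun z hz => ?_) ?_
      · obtain ⟨w, hw, -, rfl⟩ := mem_col.1 hz
        exact ih w hw (htt x hx w hw)
      · refine le_trans (card_mono fun z hz => ?_)
          ((card_img_le (col (Sig (ZFSet.pair f γ) e)) t).trans htc)
        obtain ⟨w, hw, -, rfl⟩ := mem_col.1 hz
        exact mem_img.2 ⟨w, htt x hx w hw, rfl⟩
  refine ⟨graph (col (Sig (ZFSet.pair f γ) e)) t, E.mem_of_card_le (fun p hp => ?_)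
    ((card_img_le _ _).trans htc), ?_, f, γ, rfl, y,
    pair_mem_graph.2 ⟨hAt, (hc.eq_col hAy).symm⟩, hy⟩
  · obtain ⟨x, hx, rfl⟩ := mem_img.1 hp
    exact E.pair_mem (htM x hx) (hcol x hx)
  · intro x y hxy
    obtain ⟨hx, rfl⟩ := pair_mem_graph.1 hxy
    refine ⟨fun z hz => ?_, fun w hw hs => ?_⟩
    · obtain ⟨w, hw, hs, rfl⟩ := mem_col.1 hz
      exact ⟨w, hw, hs, pair_mem_graph.2 ⟨htt x hx w hw, rfl⟩⟩
    · exact ⟨_, mem_col.2 ⟨w, hw, hs, rfl⟩, pair_mem_graph.2 ⟨htt x hx w hw, rfl⟩⟩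

end SCEmb

/-- The functions from ordinals below `κ` into `θ`. -/
def FuncLt (κ θ : ZFSet.{u}) : Set ZFSet.{u} :=
  {f | ∃ α : ZFSet, α.IsOrdinal ∧ α ∈ κ ∧ IsFuncInto α θ.toSet f}

theorem card_le_funcLt_left {κ θ t : ZFSet.{u}} (hκ : κ.IsOrdinal) (ht : t ∈ θ) :
    #κ.toSet ≤ #(FuncLt κ θ) := by
  refine mk_le_of_injective (f := fun α : κ.toSet =>
    ⟨graph (fun _ => t) α.1, α.1, hκ.mem α.2, α.2, isFuncInto_graph fun _ _ => ht⟩) ?_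
  rintro ⟨α, hα⟩ ⟨β, hβ⟩ e
  have e : graph (fun _ => t) α = graph (fun _ => t) β := congrArg Subtype.val e
  refine Subtype.ext (ZFSet.ext fun z => ?_)
  have h : ∀ d : ZFSet.{u}, z ∈ d ↔ ZFSet.pair z t ∈ graph (fun _ => t) d := fun d => by
    simp [pair_mem_graph]
  show z ∈ α ↔ z ∈ β
  rw [h α, h β, e]

theorem card_le_funcLt_right {κ θ α a : ZFSet.{u}} (hκ : κ.IsOrdinal) (hα : α ∈ κ)
    (ha : a ∈ α) : #θ.toSet ≤ #(FuncLt κ θ) := by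
  refine mk_le_of_injective (f := fun t : θ.toSet =>
    ⟨graph (fun _ => t.1) α, α, hκ.mem hα, hα, isFuncInto_graph fun _ _ => t.2⟩) ?_
  rintro ⟨s, hs⟩ ⟨t, ht⟩ e
  have e : graph (fun _ => s) α = graph (fun _ => t) α := congrArg Subtype.val e
  refine Subtype.ext ?_
  have h : ZFSet.pair a s ∈ graph (fun _ => s) α := pair_mem_graph.2 ⟨ha, rfl⟩
  rw [e] at h
  exact (pair_mem_graph.1 h).2.symm

theorem card_idxSet_le {κ τ θ : ZFSet.{u}} (hκ : κ.IsOrdinal) (hτ : τ ⊆ θ) :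
    #(idxSet κ τ).toSet ≤ #(FuncLt κ θ) * #κ.toSet := by
  have : (idxSet κ τ).toSet ⊆
      (fun p : ZFSet × ZFSet => ZFSet.pair p.1 p.2) '' (FuncLt κ θ ×ˢ κ.toSet) := by
    intro i hi
    obtain ⟨f, γ, rfl, hγ, δ, hδ, h1, h2, h3⟩ := (mem_idxSet hκ).1 hi
    refine ⟨(f, γ), ⟨⟨δ, hκ.mem hδ, hδ, fun p hp => ?_, fun a ha => ?_⟩, hγ⟩, rfl⟩
    · obtain ⟨a, ha, b, hb, rfl⟩ := h1 p hp
      exact ⟨a, b, ha, hτ hb, rfl⟩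
    · obtain ⟨b, hb, hab⟩ := h2 a ha
      refine ⟨b, hab, fun b' hab' => ?_⟩
      obtain ⟨c, _, d, hd, e⟩ := h1 _ hab'
      obtain ⟨rfl, rfl⟩ := ZFSet.pair_inj.1 e
      exact ((h3 a ha a ha b' hd b hb hab' hab).2).1 rfl
  refine (mk_le_mk_of_subset this).trans (mk_image_le.trans ?_)
  rw [mk_setProd]

/-- The guess at `γ`, given the restriction `r` to `γ` of the guessing function. -/
noncomputable def choice (κ γ r : ZFSet.{u}) : ZFSet.{u} := by
  classical exact
  if h : ∃ τ ∈ κ, ∃ A, Bad V γ τ A r then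
    (ZFSet.mem_wf.has_min {τ | τ ∈ κ ∧ ∃ A, Bad V γ τ A r} h).choose_spec.1.2.choose
  else ∅

theorem choice_spec {κ γ r : ZFSet.{u}} (h : ∃ τ ∈ κ, ∃ A, Bad V γ τ A r) :
    ∃ τ ∈ κ, Bad V γ τ (choice κ γ r) r ∧ ∀ τ' ∈ τ, τ' ∈ κ → ∀ A, ¬ Bad V γ τ' A r := by
  have hm := ZFSet.mem_wf.has_min {τ | τ ∈ κ ∧ ∃ A, Bad V γ τ A r} h
  refine ⟨hm.choose, hm.choose_spec.1.1, ?_, fun τ' hτ' hτκ A hA =>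
    hm.choose_spec.2 τ' ⟨hτκ, A, hA⟩ hτ'⟩
  rw [choice, dif_pos h]
  exact (ZFSet.mem_wf.has_min {τ | τ ∈ κ ∧ ∃ A, Bad V γ τ A r} h).choose_spec.1.2.choose_spec

open Classical in
/-- The guessing function, as a class function. -/
noncomputable def laver (κ : ZFSet.{u}) : ZFSet.{u} → ZFSet.{u} :=
  ZFSet.mem_wf.fix fun γ L => choice κ γ (graph (fun a => if h : a ∈ γ then L a h else ∅) γ)

theorem graph_congr {f g : ZFSet.{u} → ZFSet.{u}} {d : ZFSet.{u}} (h : ∀ a ∈ d, f a = g a) :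
    graph f d = graph g d := by
  refine ZFSet.ext fun p => ?_
  rw [graph, graph, mem_img, mem_img]
  exact exists_congr fun a => and_congr_right fun ha => by rw [h a ha]

theorem laver_eq (κ γ : ZFSet.{u}) : laver κ γ = choice κ γ (graph (laver κ) γ) := by
  conv_lhs => rw [laver, WellFounded.fix_eq]
  exact congrArg _ (graph_congr fun a ha => dif_pos ha)

theorem Guess.congr {M M' : Set ZFSet.{u}} {κ τ U e A ℓ ℓ' : ZFSet.{u}} (hM : M ⊆ M')
    (hκ : κ.IsOrdinal) (hU : Good M κ τ U)
    (h : ∀ γ ∈ κ, ∀ y, ZFSet.pair γ y ∈ ℓ → ZFSet.pair γ y ∈ ℓ') (hg : Guess M U e A ℓ) :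
    Guess M' U e A ℓ' := by
  refine (hU.ev_idx hg).mono ?_
  rintro i ⟨hi, c, hcM, hc, f, γ, rfl, y, hA, hy⟩
  obtain ⟨_, _, e', -, hγ⟩ := hi.eq_pair hκ
  obtain ⟨rfl, rfl⟩ := ZFSet.pair_inj.1 e'
  exact ⟨c, hM hcM, hc, _, _, rfl, y, hA, h _ hγ y hy⟩

theorem Bad.congr {M : Set ZFSet.{u}} {κ τ A ℓ ℓ' : ZFSet.{u}} (hκ : κ.IsOrdinal)
    (h : ∀ γ ∈ κ, ∀ y, ZFSet.pair γ y ∈ ℓ' → ZFSet.pair γ y ∈ ℓ) (hb : Bad M κ τ A ℓ) :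
    Bad M κ τ A ℓ' := by
  obtain ⟨e, he, hc, hU⟩ := hb
  exact ⟨e, he, hc, fun ⟨U, hUM, hg, hG⟩ => hU ⟨U, hUM, hg, hG.congr le_rfl hκ hg h⟩⟩

theorem bad_graph_iff {f : ZFSet.{u} → ZFSet.{u}} {κ γ τ A : ZFSet.{u}} (hκ : κ.IsOrdinal)
    (hγ : γ ∈ κ) : Bad V γ τ A (graph f γ) ↔ Bad V γ τ A (graph f κ) :=
  have h : ∀ δ ∈ γ, ∀ y, ZFSet.pair δ y ∈ graph f γ ↔ ZFSet.pair δ y ∈ graph f κ :=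
    fun δ hδ y => by
      rw [pair_mem_graph, pair_mem_graph, and_iff_right hδ,
        and_iff_right (hκ.mem_trans hδ hγ)]
  ⟨Bad.congr (hκ.mem hγ) fun δ hδ y => (h δ hδ y).2,
    Bad.congr (hκ.mem hγ) fun δ hδ y => (h δ hδ y).1⟩

theorem picks_laver {κ : ZFSet.{u}} (hκ : κ.IsOrdinal) : Picks V κ (graph (laver κ) κ) := by
  rintro γ hγ ⟨τ, hτ, A, -, hA⟩
  obtain ⟨σ, hσ, h1, h2⟩ := choice_spec ⟨τ, hτ, A, (bad_graph_iff hκ hγ).2 hA⟩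
  rw [← laver_eq] at h1
  refine ⟨σ, hσ, ⟨_, Set.mem_univ _, pair_mem_graph.2 ⟨hγ, rfl⟩, (bad_graph_iff hκ hγ).1 h1⟩, ?_⟩
  exact fun τ' hτ' B _ hB =>
    h2 τ' hτ' (hκ.mem_trans hτ' hσ) B ((bad_graph_iff hκ hγ).2 hB)

theorem exists_code {θ A : ZFSet.{u}} (hA : MemH θ A) :
    ∃ e, Code θ e A ∧ ∀ a x, ZFSet.pair a x ∈ e → MemH θ x := by
  obtain ⟨t, ht, hAt, hc⟩ := hA
  obtain ⟨g⟩ := hc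
  have : ∀ a, ∃ x ∈ t, ∀ y : t.toSet, a = (g y).1 → x = y.1 := fun a => by
    by_cases h : ∃ y : t.toSet, a = (g y).1
    · obtain ⟨y, rfl⟩ := h
      exact ⟨y.1, y.2, fun z hz => congrArg Subtype.val (g.injective (Subtype.ext hz))⟩
    · exact ⟨A, hAt, fun y hy => absurd ⟨y, hy⟩ h⟩
  choose f hft hf using this
  have hg : ∀ y (hy : y ∈ t), ∃ a ∈ θ, ZFSet.pair a y ∈ graph f θ := fun y hy =>
    ⟨_, (g ⟨y, hy⟩).2, pair_mem_graph.2 ⟨(g ⟨y, hy⟩).2, hf _ ⟨y, hy⟩ rfl⟩⟩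
  refine ⟨graph f θ, ⟨fun p hp => ?_, fun a ha => ⟨_, pair_mem_graph.2 ⟨ha, rfl⟩⟩, ?_, ?_,
    hg A hAt⟩, ?_⟩
  · obtain ⟨a, ha, rfl⟩ := mem_img.1 hp
    exact ⟨a, _, rfl, ha⟩
  · rintro a x hx b y hy rfl
    exact (pair_mem_graph.1 hx).2.symm.trans (pair_mem_graph.1 hy).2
  · intro a x hx y hy
    obtain ⟨-, rfl⟩ := pair_mem_graph.1 hx
    obtain ⟨b, hb, hb'⟩ := hg y (ht.mem_trans hy (hft a))
    exact ⟨b, hb', hb⟩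
  · intro a x hx
    obtain ⟨-, rfl⟩ := pair_mem_graph.1 hx
    exact ⟨t, ht, hft a, ⟨g⟩⟩

namespace SCEmb
variable {κ θ : ZFSet.{u}}

theorem mem_of_memH (E : SCEmb κ θ) {x : ZFSet.{u}} (h : MemH θ x) : x ∈ E.M := by
  obtain ⟨t, ht, hx, hc⟩ := h
  induction x using ZFSet.inductionOn with
  | _ x ih =>
    exact E.mem_of_card_le (fun y hy => ih y hy (ht.mem_trans hy hx))
      ((card_mono (ht.subset_of_mem hx)).trans hc)

theorem isOrdinal_map (E : SCEmb κ θ) : (E.e.j κ).IsOrdinal := by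
  have h := E.e.transfer E.trans ![κ] fun _ v => (∀ x ∈ v 0, ∀ y ∈ x, y ∈ v 0) ∧
    ∀ x ∈ v 0, ∀ y ∈ x, ∀ z ∈ y, z ∈ x
  obtain ⟨h1, h2⟩ := h.1 ⟨fun x hx y hy => E.isOrdinal.mem_trans hy hx,
    fun x hx y hy z hz => (E.isOrdinal.mem hx).mem_trans hz hy⟩
  exact ⟨fun x hx y hy => h1 x hx y hy, fun {x y z} hx hy hz => h2 z hz y hy x hx⟩

end SCEmb

theorem SCEmb.not_bad {κ θ τ A : ZFSet.{u}} (E : SCEmb κ θ) {f : ZFSet.{u} → ZFSet.{u}}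
    (hf : ∀ γ ∈ κ, MemV κ (f γ)) (h₀ : ℵ₀ ≤ #θ.toSet) (hκ : #κ.toSet ≤ #θ.toSet)
    (hτ : #τ.toSet ≤ #θ.toSet) (hI : 2 ^ #(idxSet κ τ).toSet ≤ #θ.toSet)
    (hτM : ∀ b ∈ τ, b ∈ E.M) (hτκ : τ ∈ E.e.j κ)
    (hA : ZFSet.pair κ A ∈ E.e.j (graph f κ)) : ¬ Bad E.M κ τ A (E.e.j (graph f κ)) := by
  rintro ⟨e, heM, he, hU⟩
  have hs := E.seed_mem_map_idxSet hτ hτM hτκ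
  have hg := E.good_measure hs
  refine hU ⟨_, E.measure_mem h₀ hκ hτ hI hτM, hg.of_V, ?_⟩
  exact (E.guess_measure hs hτ heM he hA).congr le_rfl E.isOrdinal hg.of_V
    fun γ hγ y => (E.pair_mem_map_iff hf hγ).2

theorem SCEmb.exists_scEmb_of_picks {κ lam θ A : ZFSet.{u}} (E : SCEmb κ lam)
    {f : ZFSet.{u} → ZFSet.{u}} (hf : ∀ γ ∈ κ, MemV κ (f γ)) (hp : Picks V κ (graph f κ))
    (h₀ : ℵ₀ ≤ #lam.toSet) (hκ : #κ.toSet ≤ #lam.toSet) (hθ : #θ.toSet ≤ #lam.toSet)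
    (hI : ∀ τ, τ ⊆ θ → 2 ^ #(idxSet κ τ).toSet ≤ #lam.toSet) (hθκ : θ ∈ E.e.j κ)
    (hA : MemH θ A) : ∃ E' : SCEmb κ θ, ZFSet.pair κ A ∈ E'.e.j (graph f κ) := by
  have hjκ := E.isOrdinal_map
  have hθo := hjκ.mem hθκ
  have hH : ∀ x, MemH θ x → x ∈ E.M := fun x ⟨t, h1, h2, h3⟩ =>
    E.mem_of_memH ⟨t, h1, h2, h3.trans hθ⟩
  have hM : ∀ b ∈ θ, b ∈ E.M := fun b hb => hH b ⟨θ, hθo.isTransitive, hb, le_rfl⟩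
  have hκ' : κ ∈ E.e.j κ := E.crit.2.1
  by_contra hno
  have hbad : Bad E.M κ θ A (E.e.j (graph f κ)) := by
    obtain ⟨e, he, heH⟩ := exists_code hA
    have heM : e ∈ E.M := by
      refine E.mem_of_card_le (fun p hp => ?_) ?_
      · obtain ⟨a, x, rfl, ha⟩ := he.1 p hp
        exact E.pair_mem (hM a ha) (hH x (heH a x hp))
      · refine le_trans (mk_le_of_injective (f := fun p : e.toSet =>
          (⟨(he.1 p.1 p.2).choose, (he.1 p.1 p.2).choose_spec.choose_spec.2⟩ : θ.toSet)) ?_) hθ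
        rintro ⟨p, hp⟩ ⟨q, hq⟩ hpq
        have hpq := congrArg Subtype.val hpq
        have hp' := (he.1 p hp).choose_spec.choose_spec.1
        have hq' := (he.1 q hq).choose_spec.choose_spec.1
        have := he.2.2.1 _ _ (hp' ▸ hp) _ _ (hq' ▸ hq) hpq
        exact Subtype.ext (hp'.trans ((congrArg₂ ZFSet.pair hpq this).trans hq'.symm))
    refine ⟨e, heM, he, fun ⟨U, hU, hg, hG⟩ => hno ?_⟩
    obtain ⟨β, hβ, _⟩ := E.exists_infinite
    refine exists_scEmb E.isOrdinal hθo hβ (U := U) ?_ he ?_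
    · exact E.good_V_of_good h₀ hκ hθ ((cantor _).le.trans (hI θ fun _ h => h)) hM hg
    · exact hG.congr (Set.subset_univ _) E.isOrdinal hg
        fun γ hγ y => (E.pair_mem_map_iff hf hγ).1
  obtain ⟨τ, hτ, ⟨B, -, hB, hbad'⟩, hmin⟩ := (E.e.transfer E.trans ![κ, graph f κ]
    (fun M v => Picks M (v 0) (v 1))).1 hp κ hκ' ⟨θ, hθκ, A, hH A hA, hbad⟩
  have hτθ : τ ⊆ θ := by
    rcases (hjκ.mem hτ).mem_trichotomous hθo with h | rfl | h
    · exact hθo.subset_of_mem h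
    · exact fun _ h => h
    · exact (hmin θ h A (hH A hA) hbad).elim
  exact E.not_bad hf h₀ hκ ((card_mono hτθ).trans hθ) (hI τ hτθ)
    (fun b hb => hM b (hτθ hb)) hτ hB hbad'

theorem memV_laver {κ lam : ZFSet.{u}} (E : SCEmb κ lam) (γ : ZFSet.{u}) :
    MemV κ (laver κ γ) := by
  rw [laver_eq]
  by_cases h : ∃ τ ∈ κ, ∃ A, Bad V γ τ A (graph (laver κ) γ)
  · obtain ⟨τ, hτ, ⟨e, -, he, -⟩, -⟩ := choice_spec h
    exact E.memV_of_code hτ he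
  · rw [choice, dif_neg h]
    obtain ⟨β, hβ, -⟩ := E.exists_infinite
    exact ((ZFSet.rank_empty.trans_le bot_le).trans_lt (ZFSet.rank_lt_of_mem hβ))

theorem isPFun_laver {κ lam : ZFSet.{u}} (E : SCEmb κ lam) :
    IsPFun κ (graph (laver κ) κ) := by
  refine ⟨fun p hp => ?_, fun γ A B hA hB => ?_⟩
  · obtain ⟨γ, hγ, rfl⟩ := mem_img.1 hp
    exact ⟨γ, _, hγ, memV_laver E γ, rfl⟩
  · exact (pair_mem_graph.1 hA).2.symm.trans (pair_mem_graph.1 hB).2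

theorem IsCard.eq_or_mem_of_card_le {θ lam : ZFSet.{u}} (hθ : IsCard θ) (hlam : IsCard lam)
    (h : #θ.toSet ≤ #lam.toSet) : θ = lam ∨ θ ∈ lam := by
  rcases hθ.1.mem_trichotomous hlam.1 with h' | h' | h'
  · exact .inr h'
  · exact .inl h'
  · exact ((hθ.2 _ h').not_ge h).elim

end LaverDiamond

open LaverDiamond

/-- If `κ` is `2^{θ^{<κ}}`-supercompact, then the local Laver diamond principle
`LD^{θ-sc}_κ` holds.  Here `θ^{<κ}` is the cardinality of the set of functions from
ordinals below `κ` into `θ`. -/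
theorem local_LDsc_of_supercompact (κ θ : ZFSet.{u}) (hθ : IsCard θ)
    (h : ∃ lam : ZFSet.{u}, IsCard lam ∧
        Cardinal.mk lam.toSet =
          2 ^ Cardinal.mk {f : ZFSet.{u} |
            ∃ α : ZFSet, α.IsOrdinal ∧ α ∈ κ ∧ IsFuncInto α θ.toSet f} ∧
        SCAt κ lam) :
    ∃ ℓ : ZFSet, IsPFun κ ℓ ∧
      ∀ A : ZFSet, MemH θ A → ∃ E : SCEmb κ θ, ZFSet.pair κ A ∈ E.e.j ℓ := by
  obtain ⟨lam, hlam, hc, ⟨E⟩⟩ := h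
  refine ⟨_, isPFun_laver E, fun A hA => ?_⟩
  obtain ⟨t, ht⟩ : ∃ t, t ∈ θ := by
    rcases ZFSet.eq_empty_or_nonempty θ with rfl | h
    · obtain ⟨t, -, hAt, hc⟩ := hA
      obtain ⟨g⟩ := hc
      exact (ZFSet.notMem_empty _ (g ⟨A, hAt⟩).2).elim
    · exact h
  obtain ⟨β, hβ, hβi⟩ := E.exists_infinite
  obtain ⟨⟨a, ha⟩⟩ := hβi.nonempty
  have hκν := card_le_funcLt_left E.isOrdinal ht
  have hθν : Cardinal.mk θ.toSet ≤ _ := card_le_funcLt_right E.isOrdinal hβ ha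
  have hν : Cardinal.mk (FuncLt κ θ) ≤ Cardinal.mk lam.toSet :=
    (Cardinal.cantor _).le.trans_eq hc.symm
  have h₀ : Cardinal.aleph0 ≤ Cardinal.mk (FuncLt κ θ) :=
    (Cardinal.aleph0_le_mk β.toSet).trans
      ((card_mono (E.isOrdinal.subset_of_mem hβ)).trans hκν)
  refine E.exists_scEmb_of_picks (fun γ _ => memV_laver E γ) (picks_laver E.isOrdinal) (h₀.trans hν)
    (hκν.trans hν) (hθν.trans hν) (fun τ hτ => ?_) ?_ hA
  · refine le_trans ?_ hc.symm.le
    refine Cardinal.power_le_power_left two_ne_zero ((card_idxSet_le E.isOrdinal hτ).trans ?_)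
    exact (mul_le_mul' le_rfl hκν).trans (Cardinal.mul_eq_self h₀).le
  · rcases hθ.eq_or_mem_of_card_le hlam (hθν.trans hν) with rfl | h
    · exact E.big
    · exact E.isOrdinal_map.mem_trans h E.big
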